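/- Let k be a positive integer with k ≡ 2 (mod 4). Then the composite D_2 ∘ π_1 : J_{k,1}(O_K) → S_{k+2} is an isomorphism of ℂ-vector spaces, where D_2 φ = ((k/(2πi)) ∂²φ/∂z² − 2 ∂φ/∂τ) evaluated at z = 0. -/

import Mathlib

noncomputable section

open Complex

/-- `τ` lies in the upper half plane. -/
def UHP (τ : ℂ) : Prop := 0 < τ.im

/-- `eC w = exp(2 π i w)`. -/
def eC (w : ℂ) : ℂ := Complex.exp (2 * (Real.pi : ℂ) * Complex.I * w)

/-- Entries of a matrix in `SL(2, ℤ)`, as complex numbers. -/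
def Ma (M : Matrix.SpecialLinearGroup (Fin 2) ℤ) : ℂ := ((M.1 0 0 : ℤ) : ℂ)
def Mb (M : Matrix.SpecialLinearGroup (Fin 2) ℤ) : ℂ := ((M.1 0 1 : ℤ) : ℂ)
def Mc (M : Matrix.SpecialLinearGroup (Fin 2) ℤ) : ℂ := ((M.1 1 0 : ℤ) : ℂ)
def Md (M : Matrix.SpecialLinearGroup (Fin 2) ℤ) : ℂ := ((M.1 1 1 : ℤ) : ℂ)

/-- Hermitian Jacobi form of weight `k` and index `m` for the Hermitian Jacobi group over
`ℤ[i]`.  A form is a function `φ : ℂ → ℂ → ℂ → ℂ`, all conditions being imposed for `τ`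
in the upper half plane.  Units `ε ∈ ℤ[i]ˣ = {1, -1, i, -i}`, and the elliptic variables
`λ = p + q i`, `μ = u + v i` range over `ℤ[i]`.  The Fourier expansion is indexed by
`n ∈ ℕ` and `r = (a + b i)/2 ∈ O_K^♯ = (i/2)ℤ[i]`, supported on `N(r) ≤ n m`,
i.e. `a² + b² ≤ 4 n m`. -/
structure IsHJF (k m : ℕ) (φ : ℂ → ℂ → ℂ → ℂ) : Prop where
  holo : DifferentiableOn ℂ (fun p : ℂ × ℂ × ℂ => φ p.1 p.2.1 p.2.2) {p | UHP p.1}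
  transf : ∀ ε : ℂ, ε ∈ ({1, -1, Complex.I, -Complex.I} : Set ℂ) →
    ∀ M : Matrix.SpecialLinearGroup (Fin 2) ℤ, ∀ τ z₁ z₂ : ℂ, UHP τ →
      φ ((Ma M * τ + Mb M) / (Mc M * τ + Md M))
        (ε * z₁ / (Mc M * τ + Md M))
        ((starRingEnd ℂ) ε * z₂ / (Mc M * τ + Md M))
      = ε ^ k * (Mc M * τ + Md M) ^ k *
          eC ((m : ℂ) * Mc M * z₁ * z₂ / (Mc M * τ + Md M)) * φ τ z₁ z₂
  ellip : ∀ p q u v : ℤ, ∀ τ z₁ z₂ : ℂ, UHP τ →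
      φ τ (z₁ + ((p : ℂ) + (q : ℂ) * Complex.I) * τ + ((u : ℂ) + (v : ℂ) * Complex.I))
          (z₂ + ((p : ℂ) - (q : ℂ) * Complex.I) * τ + ((u : ℂ) - (v : ℂ) * Complex.I))
      = eC (-(m : ℂ) * (((p : ℂ) ^ 2 + (q : ℂ) ^ 2) * τ
          + ((p : ℂ) - (q : ℂ) * Complex.I) * z₁
          + ((p : ℂ) + (q : ℂ) * Complex.I) * z₂)) * φ τ z₁ z₂
  fourier : ∃ c : ℕ → ℤ → ℤ → ℂ,
      (∀ (n : ℕ) (a b : ℤ), 4 * (n : ℤ) * m < a ^ 2 + b ^ 2 → c n a b = 0) ∧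
      ∀ τ z₁ z₂ : ℂ, UHP τ →
        HasSum (fun p : ℕ × ℤ × ℤ => c p.1 p.2.1 p.2.2 *
          eC ((p.1 : ℂ) * τ + (((p.2.1 : ℂ) + (p.2.2 : ℂ) * Complex.I) / 2) * z₁
            + (((p.2.1 : ℂ) - (p.2.2 : ℂ) * Complex.I) / 2) * z₂)) (φ τ z₁ z₂)

/-- Classical Jacobi form of weight `k` and index `m` for `SL(2,ℤ) ⋉ ℤ²`. -/
structure IsJF (k m : ℕ) (φ : ℂ → ℂ → ℂ) : Prop where
  holo : DifferentiableOn ℂ (fun p : ℂ × ℂ => φ p.1 p.2) {p | UHP p.1}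
  transf : ∀ M : Matrix.SpecialLinearGroup (Fin 2) ℤ, ∀ τ z : ℂ, UHP τ →
      φ ((Ma M * τ + Mb M) / (Mc M * τ + Md M)) (z / (Mc M * τ + Md M))
      = (Mc M * τ + Md M) ^ k *
          eC ((m : ℂ) * Mc M * z ^ 2 / (Mc M * τ + Md M)) * φ τ z
  ellip : ∀ p q : ℤ, ∀ τ z : ℂ, UHP τ →
      φ τ (z + (p : ℂ) * τ + (q : ℂ))
      = eC (-(m : ℂ) * ((p : ℂ) ^ 2 * τ + 2 * (p : ℂ) * z)) * φ τ z
  fourier : ∃ c : ℕ → ℤ → ℂ,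
      (∀ (n : ℕ) (r : ℤ), 4 * (n : ℤ) * m < r ^ 2 → c n r = 0) ∧
      ∀ τ z : ℂ, UHP τ →
        HasSum (fun p : ℕ × ℤ => c p.1 p.2 * eC ((p.1 : ℂ) * τ + (p.2 : ℂ) * z)) (φ τ z)

/-- Modular form of weight `k` for `SL(2,ℤ)`. -/
structure IsMF (k : ℕ) (f : ℂ → ℂ) : Prop where
  holo : DifferentiableOn ℂ f {τ | UHP τ}
  transf : ∀ M : Matrix.SpecialLinearGroup (Fin 2) ℤ, ∀ τ : ℂ, UHP τ →
      f ((Ma M * τ + Mb M) / (Mc M * τ + Md M)) = (Mc M * τ + Md M) ^ k * f τ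
  bounded : ∃ A B : ℝ, ∀ τ : ℂ, B ≤ τ.im → ‖f τ‖ ≤ A

/-- Cusp form of weight `k` for `SL(2,ℤ)`. -/
structure IsCF (k : ℕ) (f : ℂ → ℂ) : Prop where
  holo : DifferentiableOn ℂ f {τ | UHP τ}
  transf : ∀ M : Matrix.SpecialLinearGroup (Fin 2) ℤ, ∀ τ : ℂ, UHP τ →
      f ((Ma M * τ + Mb M) / (Mc M * τ + Md M)) = (Mc M * τ + Md M) ^ k * f τ
  decay : ∀ ε : ℝ, 0 < ε → ∃ B : ℝ, ∀ τ : ℂ, B ≤ τ.im → ‖f τ‖ ≤ ε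

/-- `M_w(SL(2,ℤ), ω̄)` for the character `ω` of `SL(2,ℤ)` with `ω(T) = ω(S) = i`:
holomorphic functions on the upper half plane, bounded at infinity, with
`f|_w T = -i f` and `f|_w S = -i f`. -/
structure IsMFOmegaBar (w : ℕ) (f : ℂ → ℂ) : Prop where
  holo : DifferentiableOn ℂ f {τ | UHP τ}
  transT : ∀ τ : ℂ, UHP τ → f (τ + 1) = -Complex.I * f τ
  transS : ∀ τ : ℂ, UHP τ → f (-1 / τ) = -Complex.I * τ ^ w * f τ
  bounded : ∃ A B : ℝ, ∀ τ : ℂ, B ≤ τ.im → ‖f τ‖ ≤ A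

/-- Hermitian theta function `θ^H_{m,s}` of index `m` with characteristic
`s = (a + b i)/2 ∈ O_K^♯`; the sum is over `r = s + m (g₁ + g₂ i) ∈ s + m ℤ[i]`. -/
def thetaH (m : ℕ) (a b : ℤ) (τ z₁ z₂ : ℂ) : ℂ :=
  ∑' g : ℤ × ℤ,
    eC ((((a : ℂ) + 2 * m * g.1) ^ 2 + ((b : ℂ) + 2 * m * g.2) ^ 2) / (4 * m) * τ
      + (((a : ℂ) + 2 * m * g.1) + ((b : ℂ) + 2 * m * g.2) * Complex.I) / 2 * z₁
      + (((a : ℂ) + 2 * m * g.1) - ((b : ℂ) + 2 * m * g.2) * Complex.I) / 2 * z₂)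

/-- Classical theta function `θ_{m,μ}(τ,z) = Σ_{r ≡ μ mod 2m} e(r²τ/(4m) + r z)`. -/
def thetaJ (m : ℕ) (μ : ℤ) (τ z : ℂ) : ℂ :=
  ∑' g : ℤ, eC (((μ : ℂ) + 2 * m * g) ^ 2 / (4 * m) * τ + ((μ : ℂ) + 2 * m * g) * z)

/-- `h` is the family of theta components of `φ` (for index `m`): the `h_{a,b}` depend
only on `(a, b) mod 2m` and `φ = Σ_{s ∈ O_K^♯ / m O_K} h_s θ^H_{m,s}`. -/
def HasThetaDecomp (m : ℕ) (φ : ℂ → ℂ → ℂ → ℂ) (h : ℤ → ℤ → ℂ → ℂ) : Prop :=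
  (∀ (a b : ℤ) (τ : ℂ), h (a + 2 * m) b τ = h a b τ ∧ h a (b + 2 * m) τ = h a b τ) ∧
  ∀ τ z₁ z₂ : ℂ, UHP τ →
    φ τ z₁ z₂ = ∑ a ∈ Finset.range (2 * m), ∑ b ∈ Finset.range (2 * m),
      h (a : ℤ) (b : ℤ) τ * thetaH m (a : ℤ) (b : ℤ) τ z₁ z₂

/-- `ϑ₀(τ) = Σ_{r ∈ ℤ} e(r² τ)`. -/
def theta0C (τ : ℂ) : ℂ := ∑' r : ℤ, eC ((r : ℂ) ^ 2 * τ)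

/-- `ϑ₁(τ) = Σ_{r odd} e(r² τ / 4)`. -/
def theta1C (τ : ℂ) : ℂ := ∑' r : ℤ, eC ((2 * (r : ℂ) + 1) ^ 2 * τ / 4)

/-- `ξ = ϑ₁ ϑ₀' − ϑ₀ ϑ₁'`. -/
def xiC (τ : ℂ) : ℂ := theta1C τ * deriv theta0C τ - theta0C τ * deriv theta1C τ

/-- Taylor coefficient `χ_{α,β}(τ)` of `φ(τ, z₁, z₂)` around `z₁ = z₂ = 0`. -/
def chiHJF (φ : ℂ → ℂ → ℂ → ℂ) (α β : ℕ) (τ : ℂ) : ℂ :=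
  (1 / ((α.factorial : ℂ) * (β.factorial : ℂ))) *
    iteratedDeriv α (fun z₁ => iteratedDeriv β (fun z₂ => φ τ z₁ z₂) 0) 0

/-- `D₀ : J_{k,m} → M_k`, `ψ ↦ ψ(·, 0)`. -/
def D0J (ψ : ℂ → ℂ → ℂ) : ℂ → ℂ := fun τ => ψ τ 0

/-- `D₂ : J_{k,m} → S_{k+2}`, `D₂ψ = (2k/(2πi)²) ψ₂ − (2m/(2πi)) ψ₀'`, where `ψ_ν` are
the Taylor coefficients of `ψ` around `z = 0`. -/
def D2J (k m : ℕ) (ψ : ℂ → ℂ → ℂ) : ℂ → ℂ := fun τ =>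
  (2 * (k : ℂ) / (2 * (Real.pi : ℂ) * Complex.I) ^ 2) *
      ((1 / 2) * iteratedDeriv 2 (fun z => ψ τ z) 0)
    - (2 * (m : ℂ) / (2 * (Real.pi : ℂ) * Complex.I)) * deriv (fun t => ψ t 0) τ

/-- Normalized Eisenstein series `E₄`. -/
def E4C (τ : ℂ) : ℂ :=
  1 + 240 * ∑' n : ℕ, ((ArithmeticFunction.sigma 3) n : ℂ) * eC ((n : ℂ) * τ)

/-- Normalized Eisenstein series `E₆`. -/
def E6C (τ : ℂ) : ℂ :=
  1 - 504 * ∑' n : ℕ, ((ArithmeticFunction.sigma 5) n : ℂ) * eC ((n : ℂ) * τ)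

/-- `f` agrees on the upper half plane with a polynomial in `E₄` and `E₆²` that is
homogeneous of weight `k - v`, i.e. supported on `4a + 12b + v = k`. -/
def IsE4E6sqPoly (v k : ℕ) (f : ℂ → ℂ) : Prop :=
  ∃ lam : ℕ × ℕ → ℂ, ∀ τ : ℂ, UHP τ →
    f τ = ∑ p ∈ (Finset.range (k + 1) ×ˢ Finset.range (k + 1)).filter
        (fun p => 4 * p.1 + 12 * p.2 + v = k),
      lam p * E4C τ ^ p.1 * E6C τ ^ (2 * p.2)

/-- The slash action `φ|_{k,m} M` of `M ∈ SL(2,ℤ)` on functions `ℂ → ℂ → ℂ → ℂ`. -/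
def slashHJF (k m : ℕ) (φ : ℂ → ℂ → ℂ → ℂ) (M : Matrix.SpecialLinearGroup (Fin 2) ℤ)
    (τ z₁ z₂ : ℂ) : ℂ :=
  ((Mc M * τ + Md M) ^ k)⁻¹ *
    eC (-(m : ℂ) * Mc M * z₁ * z₂ / (Mc M * τ + Md M)) *
    φ ((Ma M * τ + Mb M) / (Mc M * τ + Md M)) (z₁ / (Mc M * τ + Md M)) (z₂ / (Mc M * τ + Md M))

/-- Hermitian Jacobi form of weight `k` and index `m` for the congruence subgroup `Γ₀(N)`,
with at each cusp a Fourier expansion supported on `(n, r) ∈ ℚ_{≥0} × O_K^♯`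
with `N(r) ≤ n m`. -/
structure IsHJFLevel (k m N : ℕ) (φ : ℂ → ℂ → ℂ → ℂ) : Prop where
  holo : DifferentiableOn ℂ (fun p : ℂ × ℂ × ℂ => φ p.1 p.2.1 p.2.2) {p | UHP p.1}
  transf : ∀ ε : ℂ, ε ∈ ({1, -1, Complex.I, -Complex.I} : Set ℂ) →
    ∀ M : Matrix.SpecialLinearGroup (Fin 2) ℤ, (N : ℤ) ∣ M.1 1 0 →
    ∀ τ z₁ z₂ : ℂ, UHP τ →
      φ ((Ma M * τ + Mb M) / (Mc M * τ + Md M))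
        (ε * z₁ / (Mc M * τ + Md M))
        ((starRingEnd ℂ) ε * z₂ / (Mc M * τ + Md M))
      = ε ^ k * (Mc M * τ + Md M) ^ k *
          eC ((m : ℂ) * Mc M * z₁ * z₂ / (Mc M * τ + Md M)) * φ τ z₁ z₂
  ellip : ∀ p q u v : ℤ, ∀ τ z₁ z₂ : ℂ, UHP τ →
      φ τ (z₁ + ((p : ℂ) + (q : ℂ) * Complex.I) * τ + ((u : ℂ) + (v : ℂ) * Complex.I))
          (z₂ + ((p : ℂ) - (q : ℂ) * Complex.I) * τ + ((u : ℂ) - (v : ℂ) * Complex.I))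
      = eC (-(m : ℂ) * (((p : ℂ) ^ 2 + (q : ℂ) ^ 2) * τ
          + ((p : ℂ) - (q : ℂ) * Complex.I) * z₁
          + ((p : ℂ) + (q : ℂ) * Complex.I) * z₂)) * φ τ z₁ z₂
  cusp : ∀ M : Matrix.SpecialLinearGroup (Fin 2) ℤ,
      ∃ c : ℚ → ℤ → ℤ → ℂ,
        (∀ (n : ℚ) (a b : ℤ),
          ¬ (0 ≤ n ∧ ((a : ℚ) ^ 2 + (b : ℚ) ^ 2) ≤ 4 * n * m) → c n a b = 0) ∧
        ∀ τ z₁ z₂ : ℂ, UHP τ →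
          HasSum (fun p : ℚ × ℤ × ℤ => c p.1 p.2.1 p.2.2 *
            eC ((p.1 : ℂ) * τ + (((p.2.1 : ℂ) + (p.2.2 : ℂ) * Complex.I) / 2) * z₁
              + (((p.2.1 : ℂ) - (p.2.2 : ℂ) * Complex.I) / 2) * z₂))
            (slashHJF k m φ M τ z₁ z₂)

/-- Theta constant `x`. -/
def thConstX (τ : ℂ) : ℂ := ∑' n : ℤ, eC ((n : ℂ) ^ 2 * τ / 2)

/-- Theta constant `y`. -/
def thConstY (τ : ℂ) : ℂ := ∑' n : ℤ, (-1 : ℂ) ^ n * eC ((n : ℂ) ^ 2 * τ / 2)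

/-- Theta constant `z`. -/
def thConstZ (τ : ℂ) : ℂ := ∑' n : ℤ, eC (((n : ℂ) + 1 / 2) ^ 2 * τ / 2)

/-- `D₂ ∘ π₁` applied to a Hermitian Jacobi form:
`((k/(2πi)) ∂²/∂z² − 2 ∂/∂τ)(π₁ φ)` at `z = 0`. -/
def D2pi1 (k : ℕ) (φ : ℂ → ℂ → ℂ → ℂ) : ℂ → ℂ := fun τ =>
  ((k : ℂ) / (2 * (Real.pi : ℂ) * Complex.I)) * iteratedDeriv 2 (fun z => φ τ z z) 0
    - 2 * deriv (fun t => φ t 0 0) τ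



lemma eC_add (a b : ℂ) : eC (a + b) = eC a * eC b := by
  simp only [eC, mul_add, Complex.exp_add]
lemma eC_zero : eC 0 = 1 := by simp [eC]
lemma eC_ne_zero (a : ℂ) : eC a ≠ 0 := Complex.exp_ne_zero _
lemma eC_neg (a : ℂ) : eC (-a) = (eC a)⁻¹ := by
  simp only [eC, mul_neg, Complex.exp_neg]
lemma eC_int (n : ℤ) : eC n = 1 := by
  rw [eC, ← Complex.exp_int_mul_two_pi_mul_I n]; congr 1; ring
lemma norm_eC (a : ℂ) : ‖eC a‖ = Real.exp (-2 * Real.pi * a.im) := by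
  rw [eC, Complex.norm_exp]; congr 1; simp
lemma diff_eC : Differentiable ℂ eC := by
  unfold eC; fun_prop
lemma hasDerivAt_eC (a : ℂ) : HasDerivAt eC (2 * Real.pi * I * eC a) a := by
  have := ((hasDerivAt_id a).const_mul (2 * (Real.pi : ℂ) * I)).cexp
  refine this.congr_deriv ?_
  simp only [eC, id, mul_one]; ring

/-- generalized theta series -/
def tT (s : ℤ → ℂ) (τ u : ℂ) : ℂ := ∑' n : ℤ, s n * eC ((n : ℂ) ^ 2 / 4 * τ + n * u)

def Gr (s : ℤ → ℂ) : Prop := ∃ C : ℝ, ∃ j : ℕ, 0 ≤ C ∧ ∀ n : ℤ, ‖s n‖ ≤ C * ((|n| : ℤ) : ℝ) ^ j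

lemma term_eq (n : ℤ) (τ u : ℂ) :
    eC ((n : ℂ) ^ 2 / 4 * τ + n * u) = jacobiTheta₂_term n u (τ / 2) := by
  rw [eC, jacobiTheta₂_term]; congr 1; ring

lemma Gr.bound {s : ℤ → ℂ} (hs : Gr s) (S T : ℝ) (hT : 0 < T) :
    ∃ b : ℤ → ℝ, Summable b ∧ ∀ n : ℤ, ∀ τ u : ℂ, |u.im| ≤ S → T ≤ τ.im →
      ‖s n * eC ((n : ℂ) ^ 2 / 4 * τ + n * u)‖ ≤ b n := by
  obtain ⟨C, j, hC, h⟩ := hs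
  refine ⟨fun n => C * (((|n| : ℤ) : ℝ) ^ j * Real.exp (-Real.pi * ((T / 2) * n ^ 2 - 2 * S * ((|n| : ℤ) : ℝ)))),
    (summable_pow_mul_jacobiTheta₂_term_bound S (by positivity : 0 < T / 2) j).mul_left C, ?_⟩
  intro n τ u hu hτ
  rw [norm_mul, term_eq]
  beta_reduce
  rw [← mul_assoc]
  refine mul_le_mul (h n) ?_ (norm_nonneg _) (by positivity)
  have := norm_jacobiTheta₂_term_le (S := S) (T := T / 2) (z := u) (τ := τ / 2) (by positivity) hu
    (by simp; linarith) n
  simpa using this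

lemma Gr.summable {s : ℤ → ℂ} (hs : Gr s) {τ : ℂ} (hτ : UHP τ) (u : ℂ) :
    Summable (fun n : ℤ => s n * eC ((n : ℂ) ^ 2 / 4 * τ + n * u)) := by
  obtain ⟨b, hb, h⟩ := hs.bound |u.im| τ.im hτ
  exact Summable.of_norm_bounded hb (fun n => h n τ u le_rfl le_rfl)

lemma Gr.hasSum {s : ℤ → ℂ} (hs : Gr s) {τ : ℂ} (hτ : UHP τ) (u : ℂ) :
    HasSum (fun n : ℤ => s n * eC ((n : ℂ) ^ 2 / 4 * τ + n * u)) (tT s τ u) :=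
  (hs.summable hτ u).hasSum

lemma isOpen_UHP : IsOpen {τ : ℂ | UHP τ} := isOpen_lt continuous_const Complex.continuous_im

lemma Gr.diffOn {s : ℤ → ℂ} (hs : Gr s) (u : ℂ) :
    DifferentiableOn ℂ (fun τ => tT s τ u) {τ | UHP τ} := by
  intro τ hτ
  have hτ' : 0 < τ.im := hτ
  obtain ⟨b, hb, h⟩ := hs.bound |u.im| (τ.im / 2) (by positivity)
  have hO : IsOpen {t : ℂ | τ.im / 2 < t.im} := isOpen_lt continuous_const Complex.continuous_im
  have := Complex.differentiableOn_tsum_of_summable_norm hb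
    (F := fun n t => s n * eC ((n : ℂ) ^ 2 / 4 * t + n * u)) (U := {t : ℂ | τ.im / 2 < t.im})
    (fun n => by
      have := diff_eC
      fun_prop) hO (fun n t ht => h n t u le_rfl (le_of_lt ht))
  exact ((this.differentiableAt (hO.mem_nhds (by simp; linarith)))).differentiableWithinAt

lemma Gr.mul {s : ℤ → ℂ} (hs : Gr s) : Gr (fun n => (2 * Real.pi * I * n) * s n) := by
  obtain ⟨C, j, hC, h⟩ := hs
  refine ⟨2 * Real.pi * C, j + 1, by positivity, fun n => ?_⟩
  rw [norm_mul]
  have : ‖(2 * Real.pi * I * n : ℂ)‖ = 2 * Real.pi * ((|n| : ℤ) : ℝ) := by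
    simp [abs_of_pos Real.pi_pos]
  rw [this]
  calc _ ≤ 2 * Real.pi * ((|n| : ℤ) : ℝ) * (C * ((|n| : ℤ) : ℝ) ^ j) := by
        gcongr; exact h n
    _ = _ := by ring

lemma Gr.hasDeriv {s : ℤ → ℂ} (hs : Gr s) {τ : ℂ} (hτ : UHP τ) (u : ℂ) :
    HasDerivAt (tT s τ) (tT (fun n => (2 * Real.pi * I * n) * s n) τ u) u := by
  obtain ⟨b, hb, h⟩ := hs.bound (|u.im| + 1) τ.im hτ
  have hO : IsOpen {t : ℂ | |t.im| < |u.im| + 1} :=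
    isOpen_lt (by fun_prop) continuous_const
  have hF : ∀ n : ℤ, DifferentiableOn ℂ (fun t => s n * eC ((n : ℂ) ^ 2 / 4 * τ + n * t))
      {t : ℂ | |t.im| < |u.im| + 1} := fun n => by
        have := diff_eC
        fun_prop
  have hu : u ∈ {t : ℂ | |t.im| < |u.im| + 1} := by simp
  have h1 := Complex.hasSum_deriv_of_summable_norm hb hF hO (fun n t ht => h n τ t (le_of_lt ht) le_rfl) hu
  have h2 := (Complex.differentiableOn_tsum_of_summable_norm hb hF hO
    (fun n t ht => h n τ t (le_of_lt ht) le_rfl)).differentiableAt (hO.mem_nhds hu)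
  have h3 := hs.mul.hasSum hτ u
  have : (fun n : ℤ => deriv (fun t => s n * eC ((n : ℂ) ^ 2 / 4 * τ + n * t)) u) =
      fun n : ℤ => ((2 * Real.pi * I * n) * s n) * eC ((n : ℂ) ^ 2 / 4 * τ + n * u) := by
    funext n
    have e1 : HasDerivAt (fun t : ℂ => (n : ℂ) ^ 2 / 4 * τ + n * t) (n : ℂ) u := by
      simpa using ((hasDerivAt_id u).const_mul (n : ℂ)).const_add ((n : ℂ) ^ 2 / 4 * τ)
    have e2 := ((hasDerivAt_eC ((n : ℂ) ^ 2 / 4 * τ + n * u)).comp u e1).const_mul (s n)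
    have e3 := e2.deriv
    simp only [Function.comp_def] at e3
    rw [e3]; ring
  rw [this] at h1
  have h4 := h2.hasDerivAt
  rw [h1.unique h3] at h4
  exact h4

lemma Gr.iter {s : ℤ → ℂ} (hs : Gr s) {τ : ℂ} (hτ : UHP τ) (u : ℂ) :
    iteratedDeriv 2 (tT s τ) u = tT (fun n => (2 * Real.pi * I * n) * ((2 * Real.pi * I * n) * s n)) τ u := by
  rw [iteratedDeriv_succ, iteratedDeriv_one]
  have : deriv (tT s τ) = tT (fun n => (2 * Real.pi * I * n) * s n) τ := by
    funext v; exact (hs.hasDeriv hτ v).deriv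
  rw [this]
  exact (hs.mul.hasDeriv hτ u).deriv

def sA (n : ℤ) : ℂ := if Odd n then 1 else 0
def sB (n : ℤ) : ℂ := if Even n then 1 else 0

lemma gr_sA : Gr sA := ⟨1, 0, by norm_num, fun n => by simp only [sA]; split_ifs <;> simp⟩
lemma gr_sB : Gr sB := ⟨1, 0, by norm_num, fun n => by simp only [sB]; split_ifs <;> simp⟩

abbrev tA := tT sA
abbrev tB := tT sB

lemma tAB_add {τ : ℂ} (hτ : UHP τ) (u : ℂ) : tA τ u + tB τ u = jacobiTheta₂ u (τ / 2) := by
  have h1 := (gr_sA.hasSum hτ u).add (gr_sB.hasSum hτ u)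
  refine h1.unique ?_
  have h2 := hasSum_jacobiTheta₂_term u (τ := τ / 2) (by have : 0 < τ.im := hτ; simp; linarith)
  convert h2 using 2 with n
  rw [term_eq, sA, sB]
  rcases Int.even_or_odd n with h | h
  · simp [h, Int.not_odd_iff_even.mpr h]
  · simp [h, Int.not_even_iff_odd.mpr h]

lemma tAB_sub {τ : ℂ} (hτ : UHP τ) (u : ℂ) : tB τ u - tA τ u = jacobiTheta₂ (u + 1 / 2) (τ / 2) := by
  have h1 := (gr_sB.hasSum hτ u).sub (gr_sA.hasSum hτ u)
  refine h1.unique ?_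
  have h2 := hasSum_jacobiTheta₂_term (u + 1 / 2) (τ := τ / 2) (by have : 0 < τ.im := hτ; simp; linarith)
  refine h2.congr_fun ?_
  intro n
  rw [← term_eq, sA, sB]
  rw [show (n : ℂ) ^ 2 / 4 * τ + n * (u + 1 / 2) = ((n : ℂ) ^ 2 / 4 * τ + n * u) + n / 2 by ring, eC_add _ ((n : ℂ) / 2)]
  rcases Int.even_or_odd n with h | h
  · obtain ⟨m, hm⟩ := id h
    have : eC ((n : ℂ) / 2) = 1 := by
      rw [hm, ← eC_int m]; congr 1; push_cast; ring
    rw [this]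
    simp [h, Int.not_odd_iff_even.mpr h]
  · obtain ⟨m, hm⟩ := id h
    have : eC ((n : ℂ) / 2) = -1 := by
      rw [hm, show (((2 * m + 1 : ℤ) : ℂ) / 2) = m + 1 / 2 by push_cast; ring, eC_add, eC_int, eC,
        show 2 * (Real.pi : ℂ) * I * (1 / 2) = Real.pi * I by ring, Complex.exp_pi_mul_I]; ring
    rw [this]
    simp [h, Int.not_even_iff_odd.mpr h]

lemma tB_eq {τ : ℂ} (hτ : UHP τ) (u : ℂ) : tB τ u = jacobiTheta₂ (2 * u) (2 * τ) := by
  have h2 := hasSum_jacobiTheta₂_term (2 * u) (τ := 2 * τ) (by have : 0 < τ.im := hτ; simp; linarith)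
  refine (gr_sB.hasSum hτ u).unique ?_
  have hinj : Function.Injective (fun n : ℤ => 2 * n) := fun a b h => by simpa using h
  rw [← hinj.hasSum_iff]
  · convert h2 using 2 with n
    simp only [Function.comp, sB, even_two, Even.mul_right, if_true, one_mul]
    rw [eC, jacobiTheta₂_term]; congr 1; push_cast; ring
  · intro n hn
    have : ¬ Even n := by
      rintro ⟨m, hm⟩; exact hn ⟨m, by simp only; omega⟩
    simp [sB, this]

lemma tT_neg (s : ℤ → ℂ) (hs : ∀ n, s (-n) = s n) (τ u : ℂ) : tT s τ (-u) = tT s τ u := by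
  unfold tT
  rw [← (Equiv.neg ℤ).tsum_eq]
  refine tsum_congr fun n => ?_
  simp [hs]

lemma sA_neg (n : ℤ) : sA (-n) = sA n := by simp [sA]
lemma sB_neg (n : ℤ) : sB (-n) = sB n := by simp [sB]

lemma diff_joint (f : ℂ × ℂ × ℂ → ℂ) (hf : Differentiable ℂ f) :
    DifferentiableOn ℂ (fun p : ℂ × ℂ × ℂ => tA p.1 (f p)) {p | UHP p.1} ∧
    DifferentiableOn ℂ (fun p : ℂ × ℂ × ℂ => tB p.1 (f p)) {p | UHP p.1} := by
  have key : ∀ c : ℂ, DifferentiableOn ℂ (fun p : ℂ × ℂ × ℂ => jacobiTheta₂ (f p + c) (p.1 / 2))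
      {p | UHP p.1} := by
    intro c p hp
    have hp' : 0 < p.1.im := hp
    have h1 := (hasFDerivAt_jacobiTheta₂ (f p + c) (τ := p.1 / 2) (by simp; linarith)).differentiableAt
    have h2 : DifferentiableAt ℂ (fun p : ℂ × ℂ × ℂ => (f p + c, p.1 / 2)) p := by
      fun_prop
    exact (DifferentiableAt.comp (g := fun q : ℂ × ℂ => jacobiTheta₂ q.1 q.2) p h1 h2).differentiableWithinAt
  have k1 := key 0
  have k2 := key (1 / 2)
  constructor
  · refine ((k1.sub k2).const_mul (1 / 2)).congr ?_
    intro p hp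
    simp only [Pi.sub_apply, add_zero]
    rw [← tAB_add hp, ← tAB_sub hp]; ring
  · refine ((k1.add k2).const_mul (1 / 2)).congr ?_
    intro p hp
    simp only [Pi.add_apply, add_zero]
    rw [← tAB_add hp, ← tAB_sub hp]; ring


abbrev SLZ := Matrix.SpecialLinearGroup (Fin 2) ℤ

def Mj (M : SLZ) (τ : ℂ) : ℂ := Mc M * τ + Md M
def Mt (M : SLZ) (τ : ℂ) : ℂ := (Ma M * τ + Mb M) / (Mc M * τ + Md M)

lemma Mt_eq (M : SLZ) (τ : ℂ) (hτ : UHP τ) :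
    Mt M τ = ((M • (⟨τ, hτ⟩ : UpperHalfPlane) : UpperHalfPlane) : ℂ) := by
  rw [UpperHalfPlane.coe_specialLinearGroup_apply]
  simp [Mt, Ma, Mb, Mc, Md]

lemma Mj_eq (M : SLZ) (τ : ℂ) (hτ : UHP τ) :
    Mj M τ = UpperHalfPlane.denom (Matrix.SpecialLinearGroup.toGL
      ((Matrix.SpecialLinearGroup.map (Int.castRingHom ℝ)) M)) ((⟨τ, hτ⟩ : UpperHalfPlane) : ℂ) := by
  rw [ModularGroup.denom_apply]; rfl

lemma Mj_ne (M : SLZ) (τ : ℂ) (hτ : UHP τ) : Mj M τ ≠ 0 := by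
  rw [Mj_eq M τ hτ]; exact UpperHalfPlane.denom_ne_zero _ _

lemma Mt_UHP (M : SLZ) (τ : ℂ) (hτ : UHP τ) : UHP (Mt M τ) := by
  rw [Mt_eq M τ hτ]; exact UpperHalfPlane.im_pos _

lemma Mt_mul (M N : SLZ) (τ : ℂ) (hτ : UHP τ) : Mt (M * N) τ = Mt M (Mt N τ) := by
  rw [Mt_eq _ _ hτ, mul_smul, Mt_eq M _ (Mt_UHP N τ hτ)]
  congr 2
  apply UpperHalfPlane.ext
  exact (Mt_eq N τ hτ).symm

lemma M_det (M : SLZ) : Ma M * Md M - Mb M * Mc M = 1 := by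
  have h := M.2
  rw [Matrix.det_fin_two] at h
  simp only [Ma, Mb, Mc, Md]
  exact_mod_cast h

lemma Mc_mul (M N : SLZ) : Mc (M * N) = Mc M * Ma N + Md M * Mc N := by
  simp [Ma, Mc, Md, Matrix.mul_apply, Fin.sum_univ_two]
lemma Md_mul (M N : SLZ) : Md (M * N) = Mc M * Mb N + Md M * Md N := by
  simp [Mb, Mc, Md, Matrix.mul_apply, Fin.sum_univ_two]

lemma Mj_mul (M N : SLZ) (τ : ℂ) (hτ : UHP τ) : Mj (M * N) τ = Mj M (Mt N τ) * Mj N τ := by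
  have h := Mj_ne N τ hτ
  rw [Mj] at h
  simp only [Mj, Mt, Mc_mul, Md_mul]
  field_simp
  ring

lemma Mc_cocycle (M N : SLZ) (τ : ℂ) (hτ : UHP τ) :
    Mc (M * N) / Mj (M * N) τ = Mc M / (Mj M (Mt N τ) * Mj N τ ^ 2) + Mc N / Mj N τ := by
  have h1 := Mj_ne N τ hτ
  have h2 := Mj_ne M _ (Mt_UHP N τ hτ)
  have h3 := Mj_mul M N τ hτ
  have h4 : Mc (M * N) * Mj N τ = Mc M + Mc N * Mj (M * N) τ := by
    simp only [Mj, Mc_mul, Md_mul]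
    linear_combination (Mc M) * M_det N
  rw [h3] at h4 ⊢
  field_simp
  linear_combination h4

lemma Mt_one (τ : ℂ) : Mt 1 τ = τ := by simp [Mt, Ma, Mb, Mc, Md]
lemma Mj_one (τ : ℂ) : Mj 1 τ = 1 := by simp [Mj, Mc, Md]
lemma Mc_one : Mc 1 = 0 := by simp [Mc]

lemma tA_T (τ u : ℂ) : tA (τ + 1) u = I * tA τ u := by
  unfold tA tT
  rw [← tsum_mul_left]
  refine tsum_congr fun n => ?_
  rw [sA]
  split_ifs with h
  · obtain ⟨m, rfl⟩ := h
    rw [show ((2 * m + 1 : ℤ) : ℂ) ^ 2 / 4 * (τ + 1) + ((2 * m + 1 : ℤ) : ℂ) * u =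
      (((2 * m + 1 : ℤ) : ℂ) ^ 2 / 4 * τ + ((2 * m + 1 : ℤ) : ℂ) * u) + (((m ^ 2 + m : ℤ) : ℂ) + 1 / 4) by
        push_cast; ring, eC_add _ (((m ^ 2 + m : ℤ) : ℂ) + 1 / 4), eC_add _ (1 / 4), eC_int]
    have : eC (1 / 4) = I := by
      rw [eC, show 2 * (Real.pi : ℂ) * I * (1 / 4) = Real.pi / 2 * I by ring, Complex.exp_pi_div_two_mul_I]
    rw [this]; ring
  · simp

lemma tB_T (τ u : ℂ) : tB (τ + 1) u = tB τ u := by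
  unfold tB tT
  refine tsum_congr fun n => ?_
  rw [sB]
  split_ifs with h
  · obtain ⟨m, rfl⟩ := h
    rw [show ((m + m : ℤ) : ℂ) ^ 2 / 4 * (τ + 1) + ((m + m : ℤ) : ℂ) * u =
      (((m + m : ℤ) : ℂ) ^ 2 / 4 * τ + ((m + m : ℤ) : ℂ) * u) + ((m ^ 2 : ℤ) : ℂ) by
        push_cast; ring, eC_add _ ((m ^ 2 : ℤ) : ℂ), eC_int]
    ring
  · simp

lemma UHP_S {τ : ℂ} (hτ : UHP τ) : UHP (-1 / τ) := by
  have h := Mt_UHP ModularGroup.S τ hτ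
  simpa [Mt, Ma, Mb, Mc, Md, ModularGroup.coe_S] using h

lemma UHP_ne {τ : ℂ} (hτ : UHP τ) : τ ≠ 0 := by
  rintro rfl; simp [UHP] at hτ

lemma tAB_S {τ : ℂ} (hτ : UHP τ) : ∃ w : ℂ, w ^ 2 = -I * τ / 2 ∧ ∀ u : ℂ,
    tA (-1 / τ) (u / τ) = w * eC (u ^ 2 / τ) * (tB τ u - tA τ u) ∧
    tB (-1 / τ) (u / τ) = w * eC (u ^ 2 / τ) * (tA τ u + tB τ u) := by
  have h0 := UHP_ne hτ
  have hS := UHP_S hτ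
  have hx : -I * (τ / 2) ≠ 0 := by simp [h0]
  refine ⟨(-I * (τ / 2)) ^ (1 / 2 : ℂ), ?_, ?_⟩
  · rw [← Complex.cpow_nat_mul]
    norm_num
    ring
  intro u
  set w := (-I * (τ / 2)) ^ (1 / 2 : ℂ) with hw
  have hw0 : w ≠ 0 := by
    rw [hw, Ne, Complex.cpow_eq_zero_iff]; simp [h0]
  have hw2 : (-I * (2 * τ)) ^ (1 / 2 : ℂ) = 2 * w := by
    rw [show -I * (2 * τ) = ((4 : ℝ) : ℂ) * (-I * (τ / 2)) by push_cast; ring]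
    rw [Complex.cpow_def_of_ne_zero (by simp [h0]), Complex.log_ofReal_mul (by norm_num) hx, hw,
      Complex.cpow_def_of_ne_zero hx, add_mul, Complex.exp_add]
    congr 1
    rw [show (4 : ℝ) = 2 ^ 2 by norm_num, Real.log_pow]
    push_cast
    rw [show 2 * ((Real.log 2 : ℝ) : ℂ) * (1 / 2) = ((Real.log 2 : ℝ) : ℂ) by ring, ← Complex.ofReal_exp,
      Real.exp_log (by norm_num)]
    simp
  have f1 := jacobiTheta₂_functional_equation u (τ / 2)
  have f2 := jacobiTheta₂_functional_equation (2 * u) (2 * τ)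
  rw [hw2] at f2
  rw [← tAB_add hτ, ← hw] at f1
  rw [← tB_eq hτ] at f2
  have g1 : jacobiTheta₂ (u / (τ / 2)) (-1 / (τ / 2)) = tB (-1 / τ) (u / τ) := by
    rw [tB_eq hS]; congr 1 <;> (field_simp; try ring)
  have g2 : jacobiTheta₂ (2 * u / (2 * τ)) (-1 / (2 * τ)) = tA (-1 / τ) (u / τ) + tB (-1 / τ) (u / τ) := by
    rw [tAB_add hS]; congr 1 <;> (field_simp; try ring)
  rw [g1] at f1
  rw [g2] at f2
  have e1 : Complex.exp (-Real.pi * I * u ^ 2 / (τ / 2)) = (eC (u ^ 2 / τ))⁻¹ := by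
    rw [← eC_neg, eC]; congr 1; field_simp; try ring
  have e2 : Complex.exp (-Real.pi * I * (2 * u) ^ 2 / (2 * τ)) = (eC (u ^ 2 / τ))⁻¹ := by
    rw [← eC_neg, eC]; congr 1; field_simp; try ring
  rw [e1] at f1
  rw [e2] at f2
  have he := eC_ne_zero (u ^ 2 / τ)
  have hB : tB (-1 / τ) (u / τ) = w * eC (u ^ 2 / τ) * (tA τ u + tB τ u) := by
    rw [f1]; field_simp
  have hAB : tA (-1 / τ) (u / τ) + tB (-1 / τ) (u / τ) = 2 * w * eC (u ^ 2 / τ) * tB τ u := by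
    rw [f2]; field_simp
  refine ⟨?_, hB⟩
  linear_combination hAB - hB

def Th (τ z₁ z₂ : ℂ) : ℂ :=
  tA τ ((z₁ + z₂) / 2) * tB τ (I * (z₁ - z₂) / 2) - tB τ ((z₁ + z₂) / 2) * tA τ (I * (z₁ - z₂) / 2)

lemma Th_T (τ z₁ z₂ : ℂ) : Th (τ + 1) z₁ z₂ = I * Th τ z₁ z₂ := by
  simp only [Th]
  rw [tA_T, tB_T, tA_T, tB_T]; ring

lemma Th_S {τ : ℂ} (hτ : UHP τ) (z₁ z₂ : ℂ) :
    Th (-1 / τ) (z₁ / τ) (z₂ / τ) = I * τ * eC (z₁ * z₂ / τ) * Th τ z₁ z₂ := by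
  obtain ⟨w, hw, h⟩ := tAB_S hτ
  obtain ⟨a1, b1⟩ := h ((z₁ + z₂) / 2)
  obtain ⟨a2, b2⟩ := h (I * (z₁ - z₂) / 2)
  simp only [Th]
  rw [show (z₁ / τ + z₂ / τ) / 2 = (z₁ + z₂) / 2 / τ by ring,
    show I * (z₁ / τ - z₂ / τ) / 2 = I * (z₁ - z₂) / 2 / τ by ring, a1, b1, a2, b2]
  have : eC (z₁ * z₂ / τ) = eC (((z₁ + z₂) / 2) ^ 2 / τ) * eC ((I * (z₁ - z₂) / 2) ^ 2 / τ) := by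
    rw [← eC_add]; congr 1
    rw [div_pow, div_pow, mul_pow, I_sq]; ring
  rw [this]
  linear_combination (-2 * eC (((z₁ + z₂) / 2) ^ 2 / τ) * eC ((I * (z₁ - z₂) / 2) ^ 2 / τ) *
    (tA τ ((z₁ + z₂) / 2) * tB τ (I * (z₁ - z₂) / 2) - tB τ ((z₁ + z₂) / 2) * tA τ (I * (z₁ - z₂) / 2))) * hw

lemma Th_M (M : SLZ) : ∃ χ : ℂ, χ ^ 4 = 1 ∧ ∀ τ z₁ z₂ : ℂ, UHP τ →
    Th (Mt M τ) (z₁ / Mj M τ) (z₂ / Mj M τ) = χ * Mj M τ * eC (z₁ * z₂ * (Mc M / Mj M τ)) * Th τ z₁ z₂ := by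
  have hM : M ∈ Subgroup.closure {ModularGroup.S, ModularGroup.T} := by
    simp [SpecialLinearGroup.SL2Z_generators]
  induction hM using Subgroup.closure_induction with
  | mem x hx =>
    rcases hx with rfl | rfl
    · refine ⟨I, by simp, fun τ z₁ z₂ hτ => ?_⟩
      have h1 : Mt ModularGroup.S τ = -1 / τ := by simp [Mt, Ma, Mb, Mc, Md, ModularGroup.coe_S]
      have h2 : Mj ModularGroup.S τ = τ := by simp [Mj, Mc, Md, ModularGroup.coe_S]
      have h3 : Mc ModularGroup.S = 1 := by simp [Mc, ModularGroup.coe_S]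
      rw [h1, h2, h3, Th_S hτ, mul_one_div]
    · refine ⟨I, by simp, fun τ z₁ z₂ hτ => ?_⟩
      have h1 : Mt ModularGroup.T τ = τ + 1 := by simp [Mt, Ma, Mb, Mc, Md, ModularGroup.coe_T]
      have h2 : Mj ModularGroup.T τ = 1 := by simp [Mj, Mc, Md, ModularGroup.coe_T]
      have h3 : Mc ModularGroup.T = 0 := by simp [Mc, ModularGroup.coe_T]
      rw [h1, h2, h3, div_one, div_one, Th_T]; simp [eC_zero]
  | one => exact ⟨1, by simp, fun τ z₁ z₂ hτ => by rw [Mt_one, Mj_one, Mc_one]; simp [eC_zero]⟩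
  | mul x y _ _ hx hy =>
    obtain ⟨χ, hχ, h⟩ := hx
    obtain ⟨ψ, hψ, h'⟩ := hy
    refine ⟨χ * ψ, by rw [mul_pow, hχ, hψ, one_mul], fun τ z₁ z₂ hτ => ?_⟩
    have h1 := h (Mt y τ) (z₁ / Mj y τ) (z₂ / Mj y τ) (Mt_UHP y τ hτ)
    rw [h' τ z₁ z₂ hτ] at h1
    have hj := Mj_ne y τ hτ
    have hj2 := Mj_ne x _ (Mt_UHP y τ hτ)
    rw [Mt_mul x y τ hτ, Mc_cocycle x y τ hτ, Mj_mul x y τ hτ, mul_add, eC_add]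
    rw [div_div, div_div, mul_comm (Mj y τ)] at h1
    rw [h1]
    rw [show z₁ / Mj y τ * (z₂ / Mj y τ) * (Mc x / Mj x (Mt y τ)) =
      z₁ * z₂ * (Mc x / (Mj x (Mt y τ) * Mj y τ ^ 2)) by field_simp]
    ring
  | inv x _ hx =>
    obtain ⟨χ, hχ, h⟩ := hx
    have hχ0 : χ ≠ 0 := by rintro rfl; norm_num at hχ
    refine ⟨χ⁻¹, by rw [inv_pow, hχ, inv_one], fun τ z₁ z₂ hτ => ?_⟩
    have hU := Mt_UHP x⁻¹ τ hτ
    have h1 := h (Mt x⁻¹ τ) (z₁ / Mj x⁻¹ τ) (z₂ / Mj x⁻¹ τ) hU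
    have hj := Mj_ne x⁻¹ τ hτ
    have hj2 := Mj_ne x _ hU
    have c1 := Mj_mul x x⁻¹ τ hτ
    have c2 := Mc_cocycle x x⁻¹ τ hτ
    rw [mul_inv_cancel, Mj_one] at c1
    rw [mul_inv_cancel, Mc_one, Mj_one] at c2
    rw [← Mt_mul x x⁻¹ τ hτ, mul_inv_cancel, Mt_one, div_div, div_div, mul_comm (Mj x⁻¹ τ), ← c1,
      div_one, div_one] at h1
    rw [h1]
    have e : eC (z₁ * z₂ * (Mc x⁻¹ / Mj x⁻¹ τ)) *
        eC (z₁ / Mj x⁻¹ τ * (z₂ / Mj x⁻¹ τ) * (Mc x / Mj x (Mt x⁻¹ τ))) = 1 := by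
      rw [← eC_add, ← eC_zero]; congr 1
      rw [show z₁ / Mj x⁻¹ τ * (z₂ / Mj x⁻¹ τ) * (Mc x / Mj x (Mt x⁻¹ τ)) =
        z₁ * z₂ * (Mc x / (Mj x (Mt x⁻¹ τ) * Mj x⁻¹ τ ^ 2)) by field_simp]
      linear_combination -(z₁ * z₂) * c2
    have e2 : χ⁻¹ * χ = 1 := inv_mul_cancel₀ hχ0
    calc Th (Mt x⁻¹ τ) (z₁ / Mj x⁻¹ τ) (z₂ / Mj x⁻¹ τ)
        = 1 * 1 * 1 * Th (Mt x⁻¹ τ) (z₁ / Mj x⁻¹ τ) (z₂ / Mj x⁻¹ τ) := by ring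
      _ = (χ⁻¹ * χ) * (Mj x (Mt x⁻¹ τ) * Mj x⁻¹ τ) * (eC (z₁ * z₂ * (Mc x⁻¹ / Mj x⁻¹ τ)) *
        eC (z₁ / Mj x⁻¹ τ * (z₂ / Mj x⁻¹ τ) * (Mc x / Mj x (Mt x⁻¹ τ)))) *
          Th (Mt x⁻¹ τ) (z₁ / Mj x⁻¹ τ) (z₂ / Mj x⁻¹ τ) := by rw [e, e2, ← c1]
      _ = _ := by ring

lemma tT_ellip (s : ℤ → ℂ) (hs : ∀ n p : ℤ, s (n + 2 * p) = s n) (p q : ℤ) (τ u : ℂ) :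
    tT s τ (u + p * τ + q) = eC (-((p : ℂ) ^ 2 * τ + 2 * p * u)) * tT s τ u := by
  unfold tT
  rw [← tsum_mul_left]
  rw [← (Equiv.addRight (2 * p)).tsum_eq (fun n : ℤ => eC (-((p : ℂ) ^ 2 * τ + 2 * p * u)) *
    (s n * eC ((n : ℂ) ^ 2 / 4 * τ + n * u)))]
  refine tsum_congr fun n => ?_
  simp only [Equiv.coe_addRight, hs]
  rw [mul_left_comm, ← eC_add, show (n : ℂ) ^ 2 / 4 * τ + n * (u + p * τ + q) =
    ((n : ℂ) ^ 2 / 4 * τ + n * (u + p * τ)) + ((n * q : ℤ) : ℂ) by push_cast; ring, eC_add _ ((n * q : ℤ) : ℂ), eC_int, mul_one]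
  congr 2
  push_cast; ring

lemma sA_per (n p : ℤ) : sA (n + 2 * p) = sA n := by simp [sA, Int.odd_add]
lemma sB_per (n p : ℤ) : sB (n + 2 * p) = sB n := by simp [sB, Int.even_add]

lemma Th_ellip (p q u v : ℤ) (τ z₁ z₂ : ℂ) :
    Th τ (z₁ + ((p : ℂ) + (q : ℂ) * I) * τ + ((u : ℂ) + (v : ℂ) * I))
          (z₂ + ((p : ℂ) - (q : ℂ) * I) * τ + ((u : ℂ) - (v : ℂ) * I))
      = eC (-(((p : ℂ) ^ 2 + (q : ℂ) ^ 2) * τ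
          + ((p : ℂ) - (q : ℂ) * I) * z₁
          + ((p : ℂ) + (q : ℂ) * I) * z₂)) * Th τ z₁ z₂ := by
  simp only [Th, tA, tB]
  rw [show (z₁ + ((p : ℂ) + (q : ℂ) * I) * τ + ((u : ℂ) + (v : ℂ) * I) +
      (z₂ + ((p : ℂ) - (q : ℂ) * I) * τ + ((u : ℂ) - (v : ℂ) * I))) / 2 =
      (z₁ + z₂) / 2 + p * τ + u by ring,
    show I * (z₁ + ((p : ℂ) + (q : ℂ) * I) * τ + ((u : ℂ) + (v : ℂ) * I) -
      (z₂ + ((p : ℂ) - (q : ℂ) * I) * τ + ((u : ℂ) - (v : ℂ) * I))) / 2 =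
      I * (z₁ - z₂) / 2 + ((-q : ℤ) : ℂ) * τ + ((-v : ℤ) : ℂ) by
        push_cast; linear_combination (q * τ + v) * I_sq]
  rw [tT_ellip sA sA_per, tT_ellip sB sB_per, tT_ellip sA sA_per, tT_ellip sB sB_per]
  rw [show -(((p : ℂ) ^ 2 + (q : ℂ) ^ 2) * τ
          + ((p : ℂ) - (q : ℂ) * I) * z₁
          + ((p : ℂ) + (q : ℂ) * I) * z₂) = -((p : ℂ) ^ 2 * τ + 2 * p * ((z₁ + z₂) / 2)) +
          -((((-q : ℤ) : ℂ)) ^ 2 * τ + 2 * ((-q : ℤ) : ℂ) * (I * (z₁ - z₂) / 2)) by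
            push_cast; ring, eC_add]
  ring

lemma Th_I (τ z₁ z₂ : ℂ) : Th τ (I * z₁) (-I * z₂) = - Th τ z₁ z₂ := by
  simp only [Th, tA, tB]
  rw [show (I * z₁ + -I * z₂) / 2 = I * (z₁ - z₂) / 2 by ring,
    show I * (I * z₁ - -I * z₂) / 2 = -((z₁ + z₂) / 2) by linear_combination (z₁ + z₂) / 2 * I_sq,
    tT_neg sA sA_neg, tT_neg sB sB_neg]
  ring

lemma Th_negneg (τ z₁ z₂ : ℂ) : Th τ (-z₁) (-z₂) = Th τ z₁ z₂ := by
  simp only [Th, tA, tB]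
  rw [show (-z₁ + -z₂) / 2 = -((z₁ + z₂) / 2) by ring,
    show I * (-z₁ - -z₂) / 2 = -(I * (z₁ - z₂) / 2) by ring,
    tT_neg sA sA_neg, tT_neg sB sB_neg, tT_neg sA sA_neg, tT_neg sB sB_neg]

lemma Th_holo : DifferentiableOn ℂ (fun p : ℂ × ℂ × ℂ => Th p.1 p.2.1 p.2.2) {p | UHP p.1} := by
  have h1 := diff_joint (fun p => (p.2.1 + p.2.2) / 2) (by fun_prop)
  have h2 := diff_joint (fun p => I * (p.2.1 - p.2.2) / 2) (by fun_prop)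
  exact (h1.1.mul h2.2).sub (h1.2.mul h2.1)


lemma lemL (g1 g2 : ℂ → ℂ) (hg2 : Differentiable ℂ g2) (j χ c : ℂ) (hj : j ≠ 0)
    (h : ∀ z, g1 (z / j) = χ * eC (z * z * (c / j)) * g2 z) (h0 : g2 0 = 0) :
    iteratedDeriv 2 g1 0 = χ * j ^ 2 * iteratedDeriv 2 g2 0 := by
  have e1 : g1 = fun w => χ * eC (j * c * (w * w)) * g2 (j * w) := by
    funext w
    have := h (j * w)
    rw [mul_div_cancel_left₀ _ hj] at this
    rw [this]; congr 3; field_simp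
  have hd2 : Differentiable ℂ (deriv g2) := hg2.deriv
  have hE : ∀ w : ℂ, HasDerivAt (fun w => eC (j * c * (w * w)))
      (2 * Real.pi * I * eC (j * c * (w * w)) * (j * c * (1 * w + w * 1))) w := fun w => by
    have h1 := ((hasDerivAt_id w).mul (hasDerivAt_id w)).const_mul (j * c)
    exact HasDerivAt.comp (h₂ := eC) (h := fun w => j * c * (w * w)) w (hasDerivAt_eC (j * c * (w * w))) h1
  have hG : ∀ f : ℂ → ℂ, Differentiable ℂ f → ∀ w : ℂ,
      HasDerivAt (fun w => f (j * w)) (deriv f (j * w) * (j * 1)) w := fun f hf w =>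
    (hf (j * w)).hasDerivAt.comp w ((hasDerivAt_id w).const_mul j)
  have d1 : deriv g1 = fun w => χ * ((2 * Real.pi * I * eC (j * c * (w * w)) * (j * c * (1 * w + w * 1))) * g2 (j * w)
      + eC (j * c * (w * w)) * (deriv g2 (j * w) * (j * 1))) := by
    funext w
    have h1 := ((hE w).mul (hG g2 hg2 w)).const_mul χ
    rw [e1]
    rw [← h1.deriv]
    congr 1; funext v; simp only [Pi.mul_apply]; ring
  rw [iteratedDeriv_succ, iteratedDeriv_one, iteratedDeriv_succ, iteratedDeriv_one, d1]
  have h1 := ((((hE 0).const_mul (2 * Real.pi * I)).mul (((((hasDerivAt_id (0 : ℂ)).const_mul (1 : ℂ)).add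
    ((hasDerivAt_id (0 : ℂ)).mul_const (1 : ℂ))).const_mul (j * c)))).mul (hG g2 hg2 0)).add
      ((hE 0).mul ((hG _ hd2 0).mul_const (j * 1)))
  have h2 := h1.const_mul χ
  refine (HasDerivAt.deriv h2).trans ?_
  simp [h0, eC_zero]
  ring

def sA2 (n : ℤ) : ℂ := (2 * Real.pi * I * n) * ((2 * Real.pi * I * n) * sA n)
def sB2 (n : ℤ) : ℂ := (2 * Real.pi * I * n) * ((2 * Real.pi * I * n) * sB n)
lemma gr_sA2 : Gr sA2 := gr_sA.mul.mul
lemma gr_sB2 : Gr sB2 := gr_sB.mul.mul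

def G (τ : ℂ) : ℂ := tT sA2 τ 0 * tT sB τ 0 - tT sB2 τ 0 * tT sA τ 0

lemma Th_diag (τ z : ℂ) : Th τ z z = tT sA τ z * tT sB τ 0 - tT sB τ z * tT sA τ 0 := by
  simp [Th, tA, tB]

lemma Th_zero (τ : ℂ) : Th τ 0 0 = 0 := by rw [Th_diag]; ring

lemma Th_diag_diff {τ : ℂ} (hτ : UHP τ) : Differentiable ℂ (fun z => Th τ z z) := by
  have h1 : Differentiable ℂ (tT sA τ) := fun u => (gr_sA.hasDeriv hτ u).differentiableAt
  have h2 : Differentiable ℂ (tT sB τ) := fun u => (gr_sB.hasDeriv hτ u).differentiableAt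
  simp only [Th_diag]
  fun_prop

lemma G_eq {τ : ℂ} (hτ : UHP τ) : iteratedDeriv 2 (fun z => Th τ z z) 0 = G τ := by
  have hA : ∀ s, Gr s → ∀ u, HasDerivAt (tT s τ) (tT (fun n => (2 * Real.pi * I * n) * s n) τ u) u :=
    fun s hs u => hs.hasDeriv hτ u
  rw [iteratedDeriv_succ, iteratedDeriv_one]
  have : deriv (fun z => Th τ z z) = fun z => tT (fun n => (2 * Real.pi * I * n) * sA n) τ z * tT sB τ 0 -
      tT (fun n => (2 * Real.pi * I * n) * sB n) τ z * tT sA τ 0 := by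
    funext z
    simp only [Th_diag]
    exact (((hA _ gr_sA z).mul_const _).sub ((hA _ gr_sB z).mul_const _)).deriv
  rw [this]
  exact (((hA _ gr_sA.mul 0).mul_const _).sub ((hA _ gr_sB.mul 0).mul_const _)).deriv

lemma G_holo : DifferentiableOn ℂ G {τ | UHP τ} :=
  ((gr_sA2.diffOn 0).mul (gr_sB.diffOn 0)).sub ((gr_sB2.diffOn 0).mul (gr_sA.diffOn 0))

lemma ThG_M (M : SLZ) : ∃ χ : ℂ, χ ^ 4 = 1 ∧ (∀ τ z₁ z₂ : ℂ, UHP τ →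
    Th (Mt M τ) (z₁ / Mj M τ) (z₂ / Mj M τ) = χ * Mj M τ * eC (z₁ * z₂ * (Mc M / Mj M τ)) * Th τ z₁ z₂) ∧
    ∀ τ, UHP τ → G (Mt M τ) = χ * Mj M τ ^ 3 * G τ := by
  obtain ⟨χ, h1, h2⟩ := Th_M M
  refine ⟨χ, h1, h2, fun τ hτ => ?_⟩
  rw [← G_eq hτ, ← G_eq (Mt_UHP M τ hτ)]
  rw [lemL (fun z => Th (Mt M τ) z z) (fun z => Th τ z z) (Th_diag_diff hτ) (Mj M τ) (χ * Mj M τ) (Mc M)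
    (Mj_ne M τ hτ) (fun z => by rw [h2 τ z z hτ]) (Th_zero τ)]
  ring

abbrev imInf : Filter ℂ := Filter.comap Complex.im Filter.atTop

open Filter Topology in
lemma tT_lim (s : ℤ → ℂ) (hs : Gr s) (m : ℤ) (hm : ∀ n : ℤ, n ^ 2 < m → s n = 0) :
    Tendsto (fun τ => tT s τ 0 * eC (-(m / 4 * τ))) imInf (𝓝 (∑' n : ℤ, if n ^ 2 = m then s n else 0)) := by
  have him : Tendsto Complex.im imInf atTop := tendsto_comap
  have : (fun τ => tT s τ 0 * eC (-(m / 4 * τ))) =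
      fun τ => ∑' n : ℤ, s n * eC (((n ^ 2 - m : ℤ) : ℂ) / 4 * τ) := by
    funext τ
    rw [tT, ← tsum_mul_right]
    refine tsum_congr fun n => ?_
    rw [mul_assoc, ← eC_add]
    congr 2; push_cast; ring
  rw [this]
  have hsum := (hs.summable (τ := I) (by simp [UHP]) 0).norm.mul_left (Real.exp (2 * Real.pi * (m / 4)))
  refine tendsto_tsum_of_dominated_convergence hsum ?_ ?_
  · intro n
    by_cases h : n ^ 2 = m
    · simpa [h, eC_zero] using tendsto_const_nhds
    rw [if_neg h]
    rcases lt_or_gt_of_ne h with h | h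
    · simpa [hm n h] using tendsto_const_nhds
    rw [tendsto_zero_iff_norm_tendsto_zero]
    have h' : (0 : ℝ) < ((n ^ 2 - m : ℤ) : ℝ) := by exact_mod_cast sub_pos.mpr h
    have e : ∀ τ : ℂ, ‖s n * eC (((n ^ 2 - m : ℤ) : ℂ) / 4 * τ)‖ =
        ‖s n‖ * Real.exp (-(2 * Real.pi * (((n ^ 2 - m : ℤ) : ℝ) / 4) * τ.im)) := fun τ => by
      rw [norm_mul, norm_eC]
      rw [show ((n ^ 2 - m : ℤ) : ℂ) / 4 * τ = ((((n ^ 2 - m : ℤ) : ℝ) / 4 : ℝ) : ℂ) * τ by push_cast; ring,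
        Complex.im_ofReal_mul]
      congr 2; ring
    simp only [e]
    rw [← mul_zero ‖s n‖]
    refine Tendsto.const_mul _ ?_
    refine Real.tendsto_exp_neg_atTop_nhds_zero.comp ?_
    refine Tendsto.const_mul_atTop ?_ him
    have := Real.pi_pos
    positivity
  · filter_upwards [him.eventually_ge_atTop 1] with τ hτ n
    by_cases h : n ^ 2 < m
    · rw [hm n h]; simp
    rw [norm_mul, norm_mul, norm_eC, norm_eC, mul_left_comm, ← Real.exp_add]
    gcongr
    have h' : (0 : ℝ) ≤ ((n ^ 2 - m : ℤ) : ℝ) := by exact_mod_cast sub_nonneg.mpr (not_lt.mp h)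
    rw [show ((n ^ 2 - m : ℤ) : ℂ) / 4 * τ = ((((n ^ 2 - m : ℤ) : ℝ) / 4 : ℝ) : ℂ) * τ by push_cast; ring,
        Complex.im_ofReal_mul]
    rw [show (n : ℂ) ^ 2 / 4 * I + n * 0 = (((n : ℝ) ^ 2 / 4 : ℝ) : ℂ) * I by push_cast; ring,
        Complex.im_ofReal_mul, Complex.I_im]
    have h2 := mul_nonneg (mul_nonneg Real.pi_pos.le h') (sub_nonneg.mpr hτ)
    push_cast at h2 ⊢
    nlinarith

open Filter Topology in
lemma tT_lim0 (s : ℤ → ℂ) (hs : Gr s) : Tendsto (fun τ => tT s τ 0) imInf (𝓝 (s 0)) := by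
  have := tT_lim s hs 0 (fun n hn => absurd hn (not_lt.mpr (sq_nonneg n)))
  simpa [eC_zero] using this

open Filter Topology in
lemma tT_lim1 (s : ℤ → ℂ) (hs : Gr s) (h0 : s 0 = 0) :
    Tendsto (fun τ => tT s τ 0 * eC (-(τ / 4))) imInf (𝓝 (s 1 + s (-1))) := by
  have := tT_lim s hs 1 (fun n hn => by
    have : n = 0 := by nlinarith [Int.abs_lt_one_iff.mp ((sq_lt_one_iff_abs_lt_one n).mp hn)]
    rw [this, h0])
  have e : (∑' n : ℤ, if n ^ 2 = 1 then s n else 0) = s 1 + s (-1) := by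
    rw [tsum_eq_sum (s := {1, -1})]
    · rw [Finset.sum_pair (by norm_num)]; simp
    · intro n hn
      rw [if_neg]
      intro h
      simp at hn
      rcases mul_self_eq_one_iff.mp ((sq n).symm.trans h) with h | h <;> tauto
  rw [e] at this
  refine this.congr fun τ => ?_
  congr 2; push_cast; ring

open Filter Topology in
lemma G_lim : Tendsto (fun τ => G τ * eC (-(τ / 4))) imInf (𝓝 (2 * (2 * Real.pi * I) ^ 2)) := by
  have a2 := tT_lim1 sA2 gr_sA2 (by simp [sA2])
  have a0 := tT_lim1 sA gr_sA (by simp [sA])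
  have b2 := tT_lim0 sB2 gr_sB2
  have b0 := tT_lim0 sB gr_sB
  have := (a2.mul b0).sub (b2.mul a0)
  have e : (sA2 1 + sA2 (-1)) * sB 0 - sB2 0 * (sA 1 + sA (-1)) = 2 * (2 * Real.pi * I) ^ 2 := by
    have h1 : Odd (-1 : ℤ) := by decide
    simp [sA2, sB2, sA, sB, h1]
    ring
  rw [e] at this
  refine this.congr fun τ => ?_
  simp only [G]; ring


open Filter Topology in
lemma coe_tendsto : Tendsto (fun τ : UpperHalfPlane => (τ : ℂ)) UpperHalfPlane.atImInfty imInf := by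
  rw [tendsto_comap_iff]
  exact tendsto_comap

lemma ofReal_eC (y : ℝ) : ‖eC (y * I)‖ = Real.exp (-2 * Real.pi * y) := by
  rw [norm_eC]; simp

open Filter Topology in
lemma eC_lim : Tendsto eC imInf (𝓝 0) := by
  rw [tendsto_zero_iff_norm_tendsto_zero]
  simp only [norm_eC]
  have him : Tendsto Complex.im imInf atTop := tendsto_comap
  have := Real.tendsto_exp_neg_atTop_nhds_zero.comp (him.const_mul_atTop (by positivity : 0 < 2 * Real.pi))
  refine this.congr fun τ => ?_
  simp only [Function.comp]; congr 1; ring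

open Filter Topology in
lemma G4_lim : Tendsto (fun τ => G τ ^ 4) imInf (𝓝 0) := by
  have := (G_lim.pow 4).mul eC_lim
  rw [mul_zero] at this
  refine this.congr fun τ => ?_
  rw [mul_pow, mul_assoc]
  have : eC (-(τ / 4)) ^ 4 * eC τ = 1 := by
    rw [pow_succ, pow_succ, pow_succ, pow_one, ← eC_add, ← eC_add, ← eC_add, ← eC_add, ← eC_zero]
    congr 1; ring
  rw [this, mul_one]

open scoped MatrixGroups ModularForm in
lemma G4_slash (M : SLZ) :
    ((fun τ : UpperHalfPlane => G τ ^ 4) ∣[(12 : ℤ)] M) =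
      (fun τ : UpperHalfPlane => G τ ^ 4) := by
  funext τ
  refine (ModularForm.SL_slash_apply (k := 12) (fun τ : UpperHalfPlane => G τ ^ 4) M τ).trans ?_
  obtain ⟨χ, h1, -, h2⟩ := ThG_M M
  have h3 := h2 τ τ.2
  rw [Mt_eq M τ τ.2] at h3
  have h4 := Mj_eq M τ τ.2
  have h5 := Mj_ne M τ τ.2
  beta_reduce
  change G ((M • τ : UpperHalfPlane) : ℂ) = _ at h3
  rw [h3]
  change _ * (UpperHalfPlane.denom _ (τ : ℂ)) ^ _ = _
  change _ = UpperHalfPlane.denom _ (τ : ℂ) at h4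
  rw [← h4, mul_pow, mul_pow, h1]
  rw [show (-12 : ℤ) = -((12 : ℕ) : ℤ) by norm_num, zpow_neg, zpow_natCast]
  field_simp

open scoped MatrixGroups ModularForm in
def G4 : CuspForm 𝒮ℒ 12 where
  toFun := fun τ : UpperHalfPlane => G τ ^ 4
  slash_action_eq' A hA := by
    obtain ⟨A, rfl⟩ := hA
    exact G4_slash A
  holo' := by
    rw [UpperHalfPlane.mdifferentiable_iff]
    refine DifferentiableOn.congr (f := fun z => G z ^ 4) (G_holo.pow 4) fun z hz => ?_
    simp [UpperHalfPlane.ofComplex_apply_of_im_pos hz]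
  zero_at_cusps' hc := by
    rw [Subgroup.IsArithmetic.isCusp_iff_isCusp_SL2Z] at hc
    rw [OnePoint.isZeroAt_iff_forall_SL2Z hc]
    intro γ _
    rw [G4_slash γ]
    exact G4_lim.comp coe_tendsto

lemma imInf_neBot : imInf.NeBot := by
  refine Filter.NeBot.comap_of_range_mem inferInstance ?_
  rw [Complex.im_surjective.range_eq]
  exact Filter.univ_mem

open scoped MatrixGroups ModularForm in
open Filter Topology in
lemma G_ne {τ : ℂ} (hτ : UHP τ) : G τ ≠ 0 := by
  obtain ⟨c, hc⟩ := CuspForm.exists_smul_discriminant_of_weight_eq_twelve G4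
  have hv : ∀ t : UpperHalfPlane, c * ModularForm.discriminant t = G t ^ 4 := fun t =>
    congrArg (fun f : CuspForm 𝒮ℒ 12 => f t) hc
  have hc0 : c ≠ 0 := by
    rintro rfl
    have h1 := G_lim
    have him : Tendsto Complex.im imInf atTop := tendsto_comap
    have h2 : Tendsto (fun τ => G τ * eC (-(τ / 4))) imInf (𝓝 0) := by
      refine (tendsto_const_nhds).congr' ?_
      filter_upwards [him.eventually_gt_atTop 0] with t ht
      have := hv ⟨t, ht⟩
      rw [zero_mul] at this
      have h3 : G t = 0 := by
        have := this.symm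
        exact pow_eq_zero_iff (by norm_num) |>.mp this
      rw [h3, zero_mul]
    have := imInf_neBot
    have h3 := tendsto_nhds_unique h1 h2
    simp at h3
  intro h
  have := hv ⟨τ, hτ⟩
  change _ = G τ ^ 4 at this
  rw [h] at this
  have h2 := ModularForm.discriminant_ne_zero ⟨τ, hτ⟩
  simp [hc0, h2] at this


lemma int_eC (m : ℤ) : (∫ u in (0:ℝ)..1, eC (m * u)) = if m = 0 then 1 else 0 := by
  split_ifs with h
  · simp [h, eC_zero]
  · have h2 : (2 * (Real.pi : ℂ) * I * m) ≠ 0 := by simp [h]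
    have := integral_exp_mul_complex (a := 0) (b := 1) h2
    have e : ∀ u : ℝ, eC (m * u) = Complex.exp (2 * (Real.pi : ℂ) * I * m * u) := fun u => by
      rw [eC]; congr 1; ring
    simp only [e]
    rw [this]
    have e1 : Complex.exp (2 * (Real.pi : ℂ) * I * m * ((1 : ℝ) : ℂ)) = 1 := by
      rw [← eC_int m, eC]; congr 1; push_cast; ring
    rw [e1]; simp

open MeasureTheory in
lemma four1 {ι : Type} [Countable ι] (g : ι → ℂ) (m : ι → ℤ)
    (h : ∀ u : ℝ, HasSum (fun i => g i * eC (m i * u)) 0) :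
    HasSum (fun i => if m i = 0 then g i else 0) 0 := by
  have hn : Summable (fun i => ‖g i‖) := by
    have := (h 0).summable.norm
    simpa [eC_zero] using this
  have hne : ∀ (m : ℤ) (u : ℝ), ‖eC (m * u)‖ = 1 := fun m u => by
    rw [norm_eC, show ((m : ℂ) * u).im = 0 by simp]; simp
  have hc : ∀ m : ℤ, Continuous (fun u : ℝ => eC (m * u)) := fun m => by
    have := diff_eC.continuous; fun_prop
  have := intervalIntegral.hasSum_integral_of_dominated_convergence (μ := volume) (a := 0) (b := 1)
    (F := fun i u => g i * eC (m i * u)) (f := fun _ => 0) (fun i _ => ‖g i‖)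
    (fun i => ((hc (m i)).const_mul (g i)).aestronglyMeasurable)
    (fun i => by filter_upwards with u _; rw [norm_mul, hne, mul_one])
    (by filter_upwards with u _; exact hn) (by simp)
    (by filter_upwards with u _; exact h u)
  simp only [intervalIntegral.integral_const_mul, int_eC] at this
  simpa using this

lemma four2 (A B : ℤ → ℤ → ℂ) (F : ℂ → ℂ → ℂ)
    (hA : ∀ u v : ℂ, HasSum (fun p : ℤ × ℤ => A p.1 p.2 * eC (p.1 * u + p.2 * v)) (F u v))
    (hB : ∀ u v : ℂ, HasSum (fun p : ℤ × ℤ => B p.1 p.2 * eC (p.1 * u + p.2 * v)) (F u v)) (α β : ℤ) :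
    A α β = B α β := by
  have h1 : ∀ u v : ℝ, HasSum (fun p : ℤ × ℤ =>
      ((A p.1 p.2 - B p.1 p.2) * eC ((p.2 - β : ℤ) * v)) * eC ((p.1 - α : ℤ) * u)) 0 := fun u v => by
    have := ((hA u v).sub (hB u v)).mul_right (eC (-(α * u + β * v)))
    rw [sub_self, zero_mul] at this
    refine this.congr_fun fun p => ?_
    rw [← sub_mul, mul_assoc, mul_assoc, ← eC_add, ← eC_add]
    congr 2; push_cast; ring
  have h2 : ∀ v : ℝ, HasSum (fun p : ℤ × ℤ =>
      (if p.1 - α = 0 then (A p.1 p.2 - B p.1 p.2) else 0) * eC ((p.2 - β : ℤ) * v)) 0 := fun v => by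
    refine (four1 _ _ (fun u => h1 u v)).congr_fun fun p => ?_
    split_ifs <;> simp
  have h3 := four1 _ _ h2
  have h4 : HasSum (fun p : ℤ × ℤ => if p.2 - β = 0 then
      (if p.1 - α = 0 then (A p.1 p.2 - B p.1 p.2) else 0) else 0) (A α β - B α β) := by
    have := hasSum_single (f := fun p : ℤ × ℤ => if p.2 - β = 0 then
      (if p.1 - α = 0 then (A p.1 p.2 - B p.1 p.2) else 0) else 0) (α, β) (fun p hp => by
        split_ifs with h h'
        · exact absurd (Prod.ext (sub_eq_zero.mp h') (sub_eq_zero.mp h)) hp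
        · rfl
        · rfl)
    simpa using this
  exact sub_eq_zero.mp (h4.unique h3)

lemma hasSum_mulC {ι κ : Type} (f : ι → ℂ) (g : κ → ℂ) (a b : ℂ) (hf : HasSum f a) (hg : HasSum g b) :
    HasSum (fun p : ι × κ => f p.1 * g p.2) (a * b) := by
  have h1 : Summable (fun x => ‖f x‖) := hf.summable.norm
  have h2 : Summable (fun x => ‖g x‖) := hg.summable.norm
  have h3 : Summable (fun p : ι × κ => f p.1 * g p.2) := summable_mul_of_summable_norm h1 h2
  exact HasSum.mul hf hg h3

lemma HasThD {τ : ℂ} (hτ : UHP τ) (u v : ℂ) :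
    HasSum (fun p : ℤ × ℤ => (sA p.1 * sB p.2 - sB p.1 * sA p.2) * eC (((p.1 : ℂ) ^ 2 + (p.2 : ℂ) ^ 2) / 4 * τ)
      * eC (p.1 * u + p.2 * v)) (tT sA τ u * tT sB τ v - tT sB τ u * tT sA τ v) := by
  have key : ∀ s t : ℤ → ℂ, Gr s → Gr t → HasSum (fun p : ℤ × ℤ =>
      (s p.1 * eC ((p.1 : ℂ) ^ 2 / 4 * τ + p.1 * u)) * (t p.2 * eC ((p.2 : ℂ) ^ 2 / 4 * τ + p.2 * v)))
      (tT s τ u * tT t τ v) := fun s t hs ht => by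
    have := hasSum_mulC (fun n : ℤ => s n * eC ((n : ℂ) ^ 2 / 4 * τ + n * u))
      (fun n : ℤ => t n * eC ((n : ℂ) ^ 2 / 4 * τ + n * v)) _ _ (hs.hasSum hτ u) (ht.hasSum hτ v)
    exact this
  have a := key sA sB gr_sA gr_sB
  have b := key sB sA gr_sB gr_sA
  refine (a.sub b).congr_fun fun p => ?_
  have e : eC (((p.1 : ℂ) ^ 2 + (p.2 : ℂ) ^ 2) / 4 * τ) * eC (p.1 * u + p.2 * v) =
      eC ((p.1 : ℂ) ^ 2 / 4 * τ + p.1 * u) * eC ((p.2 : ℂ) ^ 2 / 4 * τ + p.2 * v) := by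
    rw [← eC_add, ← eC_add]; congr 1; ring
  rw [mul_assoc, e]; ring

lemma Dpar (D : ℤ → ℤ → ℂ) (h2 : ∀ a b, D (a + 2) b = D a b) (hI : ∀ a b, D b (-a) = - D a b) (a b : ℤ) :
    D a b = D 1 0 * (sA a * sB b - sB a * sA b) := by
  have h2' : ∀ a b, D a (b + 2) = D a b := fun a b => by
    have e1 := hI (b + 2) (-a)
    have e2 := hI b (-a)
    have e3 := hI (-(b+2)) (-(-a))
    have e4 := hI a (b + 2)
    have e5 := hI a b
    rw [h2, e5] at e4
    exact (neg_injective e4).symm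
  have p1 : ∀ a b n : ℤ, D (a + n * 2) b = D a b := fun a b n =>
    Function.Periodic.int_mul (f := fun x : ℤ => D x b) (c := 2) (fun x => h2 x b) n a
  have p2 : ∀ a b n : ℤ, D a (b + n * 2) = D a b := fun a b n =>
    Function.Periodic.int_mul (f := fun x : ℤ => D a x) (c := 2) (fun x => h2' a x) n b
  have z0 : D 0 0 = 0 := by
    have := hI 0 0
    simp at this
    exact self_eq_neg.mp this
  have z1 : D 1 1 = 0 := by
    have := hI 1 1
    rw [← h2' 1 (-1)] at this
    norm_num at this
    exact self_eq_neg.mp this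
  have z2 : D 0 1 = - D 1 0 := by
    have := hI 1 0
    rw [← h2' 0 (-1)] at this
    norm_num at this
    exact this
  have ev : ∀ n : ℤ, ¬ Odd (2 * n) := fun n => by simp [Int.not_odd_iff_even]
  rcases Int.even_or_odd' a with ⟨m, rfl | rfl⟩ <;> rcases Int.even_or_odd' b with ⟨n, rfl | rfl⟩
  · have := p1 0 (2 * n) m
    have h3 := p2 0 0 n
    rw [zero_add, mul_comm] at this h3
    rw [this, h3, z0]; simp [sA, sB, ev]
  · have := p1 0 (2 * n + 1) m
    have h3 := p2 0 1 n
    rw [zero_add, mul_comm] at this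
    rw [add_comm, mul_comm] at h3
    rw [this, h3, z2]; simp [sA, sB, ev]
  · have := p1 1 (2 * n) m
    have h3 := p2 1 0 n
    rw [add_comm, mul_comm] at this
    rw [zero_add, mul_comm] at h3
    rw [this, h3]; simp [sA, sB, ev]
  · have := p1 1 (2 * n + 1) m
    have h3 := p2 1 1 n
    rw [add_comm, mul_comm] at this h3
    rw [this, h3, z1]; simp [sA, sB, ev]


def CC (c : ℕ → ℤ → ℤ → ℂ) (τ : ℂ) (a b : ℤ) : ℂ := ∑' n : ℕ, c n a b * eC (n * τ)

lemma powI (k : ℕ) (hk4 : k % 4 = 2) : I ^ k = -1 := by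
  rw [← Nat.div_add_mod k 4, hk4, pow_add, pow_mul]; simp

lemma CC_hasSum (k : ℕ) (φ : ℂ → ℂ → ℂ → ℂ) (c : ℕ → ℤ → ℤ → ℂ)
    (hc : ∀ τ z₁ z₂ : ℂ, UHP τ →
        HasSum (fun p : ℕ × ℤ × ℤ => c p.1 p.2.1 p.2.2 *
          eC ((p.1 : ℂ) * τ + (((p.2.1 : ℂ) + (p.2.2 : ℂ) * Complex.I) / 2) * z₁
            + (((p.2.1 : ℂ) - (p.2.2 : ℂ) * Complex.I) / 2) * z₂)) (φ τ z₁ z₂)) {τ : ℂ} (hτ : UHP τ) (u v : ℂ) :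
    HasSum (fun p : ℤ × ℤ => CC c τ p.1 p.2 * eC (p.1 * u + p.2 * v)) (φ τ (u - I * v) (u + I * v)) := by
  have h1 := hc τ (u - I * v) (u + I * v) hτ
  have h2 : HasSum (fun q : (ℤ × ℤ) × ℕ => (c q.2 q.1.1 q.1.2 * eC (q.2 * τ)) * eC (q.1.1 * u + q.1.2 * v))
      (φ τ (u - I * v) (u + I * v)) := by
    rw [← (Equiv.prodComm ℕ (ℤ × ℤ)).hasSum_iff]
    refine h1.congr_fun fun p => ?_
    simp only [Function.comp, Equiv.prodComm_apply, Prod.swap]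
    rw [mul_assoc, ← eC_add]
    congr 2
    linear_combination ((p.2.2 : ℂ) * v) * I_sq
  refine h2.prod_fiberwise fun p => ?_
  have h3 := (h2.summable.prod_factor p)
  have h4 := h3.hasSum
  dsimp only at h4 ⊢
  rw [tsum_mul_right] at h4
  exact h4

lemma CC_diff (a : ℕ → ℂ) (h : ∀ τ, UHP τ → Summable (fun n : ℕ => a n * eC (n * τ))) :
    DifferentiableOn ℂ (fun τ => ∑' n : ℕ, a n * eC (n * τ)) {τ | UHP τ} := by
  intro τ hτ
  have hτ' : 0 < τ.im := hτ
  have hO : IsOpen {t : ℂ | τ.im / 2 < t.im} := isOpen_lt continuous_const Complex.continuous_im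
  have hb := (h (((τ.im / 2 : ℝ) : ℂ) * I) (by simp [UHP]; linarith)).norm
  have := Complex.differentiableOn_tsum_of_summable_norm hb
    (F := fun n t => a n * eC (n * t)) (U := {t : ℂ | τ.im / 2 < t.im})
    (fun n => by
      have := diff_eC
      fun_prop) hO (fun n t ht => by
      rw [norm_mul, norm_mul]
      gcongr
      rw [norm_eC, norm_eC]
      apply Real.exp_le_exp.mpr
      have ht' : τ.im / 2 < t.im := ht
      have e1 : ((n : ℂ) * t).im = n * t.im := by simp
      have e2 : ((n : ℂ) * (((τ.im / 2 : ℝ) : ℂ) * I)).im = n * (τ.im / 2) := by simp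
      rw [e1, e2]
      have : (n : ℝ) * (τ.im / 2) ≤ n * t.im := by gcongr
      nlinarith [Real.pi_pos])
  exact (this.differentiableAt (hO.mem_nhds (by simp only [Set.mem_ofPred_eq]; linarith))).differentiableWithinAt

open Filter Topology in
lemma CC_lim (a : ℕ → ℂ) (h : ∀ τ, UHP τ → Summable (fun n : ℕ => a n * eC (n * τ))) (h0 : a 0 = 0) :
    Tendsto (fun τ => ∑' n : ℕ, a n * eC (n * τ)) imInf (𝓝 0) := by
  have him : Tendsto Complex.im imInf atTop := tendsto_comap
  have hb := (h I (by simp [UHP])).norm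
  rw [show (0 : ℂ) = ∑' n : ℕ, (0 : ℂ) by simp]
  have hn : ∀ (n : ℕ) (τ : ℂ), ‖a n * eC (n * τ)‖ = ‖a n‖ * Real.exp (-(2 * Real.pi * n * τ.im)) := fun n τ => by
    rw [norm_mul, norm_eC]; congr 2; simp; ring
  refine tendsto_tsum_of_dominated_convergence hb ?_ ?_
  · intro n
    rcases Nat.eq_zero_or_pos n with rfl | hn0
    · simpa [h0] using tendsto_const_nhds
    rw [tendsto_zero_iff_norm_tendsto_zero]
    simp only [hn]
    rw [← mul_zero ‖a n‖]
    refine Tendsto.const_mul _ ?_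
    refine Real.tendsto_exp_neg_atTop_nhds_zero.comp ?_
    refine Tendsto.const_mul_atTop ?_ him
    have := Real.pi_pos
    positivity
  · filter_upwards [him.eventually_ge_atTop 1] with τ hτ n
    rw [hn, hn]
    gcongr
    simpa using hτ

open Filter Topology in
lemma decomp (k : ℕ) (hk4 : k % 4 = 2) (φ : ℂ → ℂ → ℂ → ℂ) (hφ : IsHJF k 1 φ) :
    ∃ C : ℂ → ℂ, DifferentiableOn ℂ C {τ | UHP τ} ∧ Tendsto C imInf (𝓝 0) ∧
      ∀ τ z₁ z₂, UHP τ → φ τ z₁ z₂ = C τ * eC (-(τ / 4)) * Th τ z₁ z₂ := by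
  obtain ⟨c, hsupp, hc⟩ := hφ.fourier
  have hs : ∀ τ, UHP τ → Summable (fun n : ℕ => c n 1 0 * eC (n * τ)) := fun τ hτ => by
    have h1 := (hc τ 0 0 hτ).summable
    have hinj : Function.Injective (fun n : ℕ => (n, (1 : ℤ), (0 : ℤ))) := fun a b h => by simpa using h
    have h2 := h1.comp_injective hinj
    simpa [Function.comp_def] using h2
  refine ⟨fun τ => CC c τ 1 0, CC_diff _ hs, CC_lim _ hs (hsupp 0 1 0 (by norm_num)), fun τ z₁ z₂ hτ => ?_⟩
  have hF := CC_hasSum k φ c hc hτ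
  set F : ℂ → ℂ → ℂ := fun u v => φ τ (u - I * v) (u + I * v) with hFd
  have hF' : ∀ u v, HasSum (fun p : ℤ × ℤ => CC c τ p.1 p.2 * eC (p.1 * u + p.2 * v)) (F u v) := hF
  -- elliptic law
  have hE : ∀ a b : ℤ, CC c τ a b * eC (a * τ) = CC c τ (a + 2) b * eC (-τ) := by
    refine four2 (fun a b => CC c τ a b * eC (a * τ)) (fun a b => CC c τ (a + 2) b * eC (-τ))
      (fun u v => F (u + τ) v) ?_ ?_
    · intro u v
      refine (hF' (u + τ) v).congr_fun fun p => ?_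
      rw [mul_assoc, ← eC_add]; congr 2; ring
    · intro u v
      have h1 : F (u + τ) v = eC (-(τ + 2 * u)) * F u v := by
        have := hφ.ellip 1 0 0 0 τ (u - I * v) (u + I * v) hτ
        simp only [hFd]
        rw [show u + τ - I * v = u - I * v + (((1 : ℤ) : ℂ) + ((0 : ℤ) : ℂ) * I) * τ + (((0 : ℤ) : ℂ) + ((0 : ℤ) : ℂ) * I) by
          push_cast; ring,
          show u + τ + I * v = u + I * v + (((1 : ℤ) : ℂ) - ((0 : ℤ) : ℂ) * I) * τ + (((0 : ℤ) : ℂ) - ((0 : ℤ) : ℂ) * I) by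
          push_cast; ring, this]
        congr 2; push_cast; ring
      rw [h1, ← (Equiv.prodCongr (Equiv.addRight (-2 : ℤ)) (Equiv.refl ℤ)).hasSum_iff]
      refine ((hF' u v).mul_left (eC (-(τ + 2 * u)))).congr_fun fun p => ?_
      simp only [Function.comp, Equiv.prodCongr_apply, Prod.map, Equiv.coe_addRight, Equiv.refl_apply]
      rw [neg_add_cancel_right, mul_left_comm, ← eC_add, mul_assoc, ← eC_add]
      congr 2; push_cast; ring
  have hI : ∀ a b : ℤ, CC c τ b (-a) = - CC c τ a b := by
    refine four2 (fun a b => CC c τ b (-a)) (fun a b => - CC c τ a b) (fun u v => F v (-u)) ?_ ?_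
    · intro u v
      rw [← (((Equiv.neg ℤ).prodCongr (Equiv.refl ℤ)).trans (Equiv.prodComm ℤ ℤ)).symm.hasSum_iff]
      refine (hF' v (-u)).congr_fun fun p => ?_
      simp [Function.comp]
      left; congr 1; ring
    · intro u v
      have h1 : F v (-u) = - F u v := by
        have := hφ.transf I (by simp) 1 τ (u - I * v) (u + I * v) hτ
        have e1 := Mt_one τ
        have e2 := Mj_one τ
        rw [Mt] at e1
        rw [Mj] at e2
        rw [e1, e2, powI k hk4, Mc_one] at this
        simp [eC_zero] at this
        simp only [hFd]
        rw [← this]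
        congr 1
        · linear_combination v * I_sq
        · linear_combination v * I_sq
      rw [h1]
      refine (hF' u v).neg.congr_fun fun p => ?_
      ring
  have hD := Dpar (fun a b => CC c τ a b * eC (-(((a : ℂ) ^ 2 + (b : ℂ) ^ 2) / 4 * τ))) (fun a b => by
      have h1 := hE a b
      have e : CC c τ (a + 2) b = CC c τ a b * eC (a * τ) * eC τ := by
        rw [h1, mul_assoc, ← eC_add, neg_add_cancel, eC_zero, mul_one]
      beta_reduce
      rw [e, mul_assoc, mul_assoc, ← eC_add, ← eC_add]; congr 2; push_cast; ring) (fun a b => by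
      beta_reduce
      rw [hI, neg_mul]; congr 3; push_cast; ring)
  have hCf : ∀ a b : ℤ, CC c τ a b = CC c τ 1 0 * eC (-(τ / 4)) *
      ((sA a * sB b - sB a * sA b) * eC (((a : ℂ) ^ 2 + (b : ℂ) ^ 2) / 4 * τ)) := fun a b => by
    have h1 := hD a b
    beta_reduce at h1
    have h2 : CC c τ a b = CC c τ a b * eC (-(((a : ℂ) ^ 2 + (b : ℂ) ^ 2) / 4 * τ)) *
      eC (((a : ℂ) ^ 2 + (b : ℂ) ^ 2) / 4 * τ) := by
        rw [mul_assoc, ← eC_add, neg_add_cancel, eC_zero, mul_one]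
    rw [h2, h1]
    have : -((((1 : ℤ) : ℂ) ^ 2 + ((0 : ℤ) : ℂ) ^ 2) / 4 * τ) = -(τ / 4) := by push_cast; ring
    rw [this]; ring
  have hu := (HasThD hτ ((z₁ + z₂) / 2) (I * (z₁ - z₂) / 2)).mul_left (CC c τ 1 0 * eC (-(τ / 4)))
  have hf := hF' ((z₁ + z₂) / 2) (I * (z₁ - z₂) / 2)
  have e1 : F ((z₁ + z₂) / 2) (I * (z₁ - z₂) / 2) = φ τ z₁ z₂ := by
    simp only [hFd]; congr 1
    · linear_combination (-(z₁ - z₂) / 2) * I_sq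
    · linear_combination ((z₁ - z₂) / 2) * I_sq
  rw [e1] at hf
  refine hf.unique (hu.congr_fun fun p => ?_)
  rw [hCf p.1 p.2]; ring

open Filter Topology

lemma D2_formula (k : ℕ) (φ : ℂ → ℂ → ℂ → ℂ) (H : ℂ → ℂ)
    (h : ∀ τ z₁ z₂, UHP τ → φ τ z₁ z₂ = H τ * Th τ z₁ z₂) {τ : ℂ} (hτ : UHP τ) :
    D2pi1 k φ τ = ((k : ℂ) / (2 * (Real.pi : ℂ) * Complex.I)) * (H τ * G τ) := by
  have h1 := lemL (fun z => φ τ z z) (fun z => Th τ z z) (Th_diag_diff hτ) 1 (H τ) 0 one_ne_zero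
    (fun z => by simp [h τ z z hτ, eC_zero]) (Th_zero τ)
  have h2 : deriv (fun t => φ t 0 0) τ = 0 := by
    have : (fun t => φ t 0 0) =ᶠ[𝓝 τ] fun _ => (0 : ℂ) := by
      filter_upwards [isOpen_UHP.mem_nhds hτ] with t ht
      rw [h t 0 0 ht, Th_zero, mul_zero]
    rw [this.deriv_eq]; simp
  rw [D2pi1, h1, h2, G_eq hτ]; simp

lemma im_tendsto_dec (f : ℂ → ℂ) (h : Tendsto f imInf (𝓝 0)) (ε : ℝ) (hε : 0 < ε) :
    ∃ B : ℝ, 0 < B ∧ ∀ τ : ℂ, B ≤ τ.im → ‖f τ‖ ≤ ε := by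
  have h1 : ∀ᶠ τ in imInf, ‖f τ‖ < ε := by
    have := h.norm
    rw [norm_zero] at this
    exact this.eventually_lt_const hε
  rw [imInf, eventually_comap, eventually_atTop] at h1
  obtain ⟨B, hB⟩ := h1
  exact ⟨max B 1, by positivity, fun τ hτ => (hB τ.im ((le_max_left _ _).trans hτ) τ rfl).le⟩

lemma dec_im_tendsto (f : ℂ → ℂ) (h : ∀ ε : ℝ, 0 < ε → ∃ B : ℝ, ∀ τ : ℂ, B ≤ τ.im → ‖f τ‖ ≤ ε) :
    Tendsto f imInf (𝓝 0) := by
  rw [Metric.tendsto_nhds]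
  intro ε hε
  obtain ⟨B, hB⟩ := h (ε / 2) (by positivity)
  have him : Tendsto Complex.im imInf atTop := tendsto_comap
  filter_upwards [him.eventually_ge_atTop B] with t ht
  rw [dist_zero_right]
  linarith [hB t ht]

lemma part1 (k : ℕ) (hk4 : k % 4 = 2) (φ : ℂ → ℂ → ℂ → ℂ) (hφ : IsHJF k 1 φ) :
    IsCF (k + 2) (D2pi1 k φ) := by
  obtain ⟨C, hC1, hC2, hC3⟩ := decomp k hk4 φ hφ
  have hD := fun τ (hτ : UHP τ) => D2_formula k φ (fun τ => C τ * eC (-(τ / 4))) hC3 hτ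
  refine ⟨?_, ?_, ?_⟩
  · refine DifferentiableOn.congr ?_ hD
    have : Differentiable ℂ fun τ => eC (-(τ / 4)) := diff_eC.comp (by fun_prop)
    exact ((hC1.mul this.differentiableOn).mul G_holo).const_mul _
  · intro M τ hτ
    have hj := Mj_ne M τ hτ
    have e0 : ∀ t, UHP t → φ t 0 0 = 0 := fun t ht => by rw [hC3 t 0 0 ht, Th_zero, mul_zero]
    have hd : ∀ t, UHP t → deriv (fun t => φ t 0 0) t = 0 := fun t ht => by
      have : (fun t => φ t 0 0) =ᶠ[𝓝 t] fun _ => (0 : ℂ) := by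
        filter_upwards [isOpen_UHP.mem_nhds ht] with t ht
        exact e0 t ht
      rw [this.deriv_eq]; simp
    have hdiff : Differentiable ℂ (fun z => φ τ z z) := by
      have : (fun z => φ τ z z) = fun z => (C τ * eC (-(τ / 4))) * Th τ z z :=
        funext fun z => hC3 τ z z hτ
      rw [this]
      exact (Th_diag_diff hτ).const_mul _
    have h1 := lemL (fun z => φ (Mt M τ) z z) (fun z => φ τ z z) hdiff (Mj M τ) (Mj M τ ^ k) (Mc M) hj
      (fun z => by
        have := hφ.transf 1 (by simp) M τ z z hτ
        simp only [map_one, one_mul, one_pow, Nat.cast_one] at this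
        refine this.trans ?_
        congr 3
        rw [Mj]; ring) (e0 τ hτ)
    change D2pi1 k φ (Mt M τ) = (Mj M τ) ^ (k + 2) * _
    rw [D2pi1, D2pi1, hd τ hτ, hd _ (Mt_UHP M τ hτ), h1]
    ring
  · intro ε hε
    have h1 : Tendsto (fun τ => ((k : ℂ) / (2 * (Real.pi : ℂ) * Complex.I)) *
        (C τ * (G τ * eC (-(τ / 4))))) imInf (𝓝 0) := by
      have := (hC2.mul G_lim).const_mul ((k : ℂ) / (2 * (Real.pi : ℂ) * Complex.I))
      simpa using this
    obtain ⟨B, hB0, hB⟩ := im_tendsto_dec _ h1 ε hε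
    refine ⟨B, fun τ hτ => ?_⟩
    rw [hD τ (hB0.trans_le hτ)]
    refine le_trans (le_of_eq ?_) (hB τ hτ)
    congr 1; ring

lemma kap_ne (k : ℕ) (hk : 0 < k) : ((k : ℂ) / (2 * (Real.pi : ℂ) * Complex.I)) ≠ 0 := by
  have : (k : ℂ) ≠ 0 := by exact_mod_cast hk.ne'
  simp [this, Real.pi_ne_zero]

lemma part2 (k : ℕ) (hk : 0 < k) (hk4 : k % 4 = 2) (φ φ' : ℂ → ℂ → ℂ → ℂ)
    (hφ : IsHJF k 1 φ) (hφ' : IsHJF k 1 φ')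
    (h : ∀ τ : ℂ, UHP τ → D2pi1 k φ τ = D2pi1 k φ' τ) (τ z₁ z₂ : ℂ) (hτ : UHP τ) :
    φ τ z₁ z₂ = φ' τ z₁ z₂ := by
  obtain ⟨C, -, -, hC3⟩ := decomp k hk4 φ hφ
  obtain ⟨C', -, -, hC3'⟩ := decomp k hk4 φ' hφ'
  have h1 := h τ hτ
  rw [D2_formula k φ (fun τ => C τ * eC (-(τ / 4))) hC3 hτ,
    D2_formula k φ' (fun τ => C' τ * eC (-(τ / 4))) hC3' hτ] at h1
  have h2 := mul_right_cancel₀ (G_ne hτ) (mul_left_cancel₀ (kap_ne k hk) h1)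
  rw [hC3 τ z₁ z₂ hτ, hC3' τ z₁ z₂ hτ, h2]

lemma G_T {τ : ℂ} (hτ : UHP τ) : G (τ + 1) = I * G τ := by
  have h' : UHP (τ + 1) := by simpa [UHP] using hτ
  have h1 := lemL (fun z => Th (τ + 1) z z) (fun z => Th τ z z) (Th_diag_diff hτ) 1 I 0 one_ne_zero
    (fun z => by simp [Th_T, eC_zero]) (Th_zero τ)
  rw [G_eq hτ, G_eq h'] at h1
  simpa using h1

lemma eC_quarter : eC (1 / 4) = I := by
  rw [eC, show 2 * (Real.pi : ℂ) * I * (1 / 4) = Real.pi / 2 * I by ring, Complex.exp_pi_div_two_mul_I]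

lemma Th_eps (k : ℕ) (hk4 : k % 4 = 2) (ε : ℂ) (hε : ε ∈ ({1, -1, Complex.I, -Complex.I} : Set ℂ))
    (τ z₁ z₂ : ℂ) : Th τ (ε * z₁) ((starRingEnd ℂ) ε * z₂) = ε ^ k * Th τ z₁ z₂ := by
  have hev : Even k := by rw [Nat.even_iff]; omega
  rcases hε with rfl | rfl | rfl | rfl
  · simp
  · simp [hev.neg_pow, Th_negneg]
  · rw [powI k hk4, conj_I, Th_I]; ring
  · rw [hev.neg_pow, powI k hk4, map_neg, conj_I]
    have := Th_I τ (-z₁) (-z₂)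
    rw [Th_negneg] at this
    rw [show -I * z₁ = I * -z₁ by ring, show - -I * z₂ = -I * -z₂ by ring, this]; ring

/-- q-expansion of periodic functions. -/
lemma qexp (g : ℂ → ℂ) (hg : DifferentiableOn ℂ g {τ | UHP τ}) (hT : ∀ τ, UHP τ → g (τ + 1) = g τ)
    (hlim : Tendsto g imInf (𝓝 0)) :
    ∃ d : ℕ → ℂ, d 0 = 0 ∧ ∀ τ, UHP τ → HasSum (fun n : ℕ => d n * eC (n * τ)) (g τ) := by
  set f : UpperHalfPlane → ℂ := fun τ => g τ with hf
  have hz : UpperHalfPlane.IsZeroAtImInfty f := hlim.comp coe_tendsto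
  have hper : Function.Periodic (f ∘ UpperHalfPlane.ofComplex) (1 : ℝ) := by
    intro w
    by_cases! hw : 0 < w.im
    · have h2 : 0 < (w + (1 : ℝ)).im := by simpa using hw
      simp only [Function.comp_apply, UpperHalfPlane.ofComplex_apply_of_im_pos h2,
        UpperHalfPlane.ofComplex_apply_of_im_pos hw]
      have := hT w hw
      simpa [hf] using this
    · have h2 : (w + (1 : ℝ)).im ≤ 0 := by simpa using hw
      simp only [Function.comp_apply, UpperHalfPlane.ofComplex_apply_of_im_nonpos h2,
        UpperHalfPlane.ofComplex_apply_of_im_nonpos hw]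
  have hhol : MDifferentiable (modelWithCornersSelf ℂ ℂ) (modelWithCornersSelf ℂ ℂ) f := by
    rw [UpperHalfPlane.mdifferentiable_iff]
    refine DifferentiableOn.congr (f := g) hg fun z hz => ?_
    simp [hf, UpperHalfPlane.ofComplex_apply_of_im_pos hz]
  have hb : UpperHalfPlane.IsBoundedAtImInfty f := hz.isBoundedAtImInfty
  refine ⟨fun n => (UpperHalfPlane.qExpansion 1 f).coeff n, ?_, fun τ hτ => ?_⟩
  · have h1 := UpperHalfPlane.qExpansion_coeff_zero (h := 1) one_pos
      (UpperHalfPlane.analyticAt_cuspFunction_zero one_pos hper hhol hb) hper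
    simp only [h1]
    exact hz.valueAtInfty_eq_zero
  · have h1 := UpperHalfPlane.hasSum_qExpansion (h := 1) one_pos hper hhol hb ⟨τ, hτ⟩
    refine (h1.congr_fun ?_ : HasSum _ (g τ))
    intro n
    simp only [smul_eq_mul]
    congr 1
    rw [Function.Periodic.qParam, ← Complex.exp_nat_mul, eC]
    congr 1
    simp; ring


open Filter Topology

def eN (a b : ℤ) : ℕ := ((a ^ 2 + b ^ 2 - 1) / 4).toNat
def cf (a b : ℤ) : ℂ := sA a * sB b - sB a * sA b

lemma cf_or (a b : ℤ) : cf a b = 0 ∨ a ^ 2 + b ^ 2 = 4 * (eN a b : ℤ) + 1 := by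
  have key : ∀ x y : ℤ, (x + x) ^ 2 + (2 * y + 1) ^ 2 = 4 * (x ^ 2 + y ^ 2 + y) + 1 ∧ 0 ≤ x ^ 2 + y ^ 2 + y := by
    intro x y
    refine ⟨by ring, ?_⟩
    rcases le_or_gt 0 y with h | h
    · positivity
    · nlinarith [sq_nonneg x]
  rcases Int.even_or_odd a with ha | ha <;> rcases Int.even_or_odd b with hb | hb
  · left
    have h1 : ¬ Odd a := by simpa using ha
    have h2 : ¬ Odd b := by simpa using hb
    simp [cf, sA, h1, h2]
  · right
    obtain ⟨x, rfl⟩ := ha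
    obtain ⟨y, rfl⟩ := hb
    obtain ⟨h1, h2⟩ := key x y
    rw [eN, h1]; omega
  · right
    obtain ⟨y, rfl⟩ := ha
    obtain ⟨x, rfl⟩ := hb
    obtain ⟨h1, h2⟩ := key x y
    rw [add_comm] at h1
    rw [eN, h1]; omega
  · left
    have h1 : ¬ Even a := by simpa using ha
    have h2 : ¬ Even b := by simpa using hb
    simp [cf, sB, h1, h2]

lemma four_part (H : ℂ → ℂ) (d : ℕ → ℂ) (d0 : d 0 = 0)
    (hd : ∀ τ, UHP τ → HasSum (fun n : ℕ => d n * eC (n * τ)) (H τ * eC (τ / 4))) :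
    ∃ c : ℕ → ℤ → ℤ → ℂ, (∀ (n : ℕ) (a b : ℤ), 4 * (n : ℤ) < a ^ 2 + b ^ 2 → c n a b = 0) ∧
      ∀ τ z₁ z₂ : ℂ, UHP τ →
        HasSum (fun p : ℕ × ℤ × ℤ => c p.1 p.2.1 p.2.2 *
          eC ((p.1 : ℂ) * τ + (((p.2.1 : ℂ) + (p.2.2 : ℂ) * Complex.I) / 2) * z₁
            + (((p.2.1 : ℂ) - (p.2.2 : ℂ) * Complex.I) / 2) * z₂)) (H τ * Th τ z₁ z₂) := by
  refine ⟨fun N a b => if eN a b ≤ N then cf a b * d (N - eN a b) else 0, ?_, ?_⟩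
  · intro N a b h
    beta_reduce
    split_ifs with h1
    · rcases cf_or a b with h2 | h2
      · rw [h2, zero_mul]
      · have : N - eN a b = 0 := by omega
        rw [this, d0, mul_zero]
    · rfl
  · intro τ z₁ z₂ hτ
    set ι : ℕ × ℤ × ℤ → ℕ × ℤ × ℤ := fun p => (p.1 + eN p.2.1 p.2.2, p.2.1, p.2.2) with hι
    have hinj : Function.Injective ι := by
      rintro ⟨n, a, b⟩ ⟨n', a', b'⟩ h
      simp only [hι, Prod.mk.injEq] at h
      obtain ⟨h1, rfl, rfl⟩ := h
      simpa using h1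
    rw [← hinj.hasSum_iff]
    · have h1 := HasThD hτ ((z₁ + z₂) / 2) (I * (z₁ - z₂) / 2)
      have h2 := hasSum_mulC (fun n : ℕ => d n * eC (n * τ)) (fun p : ℤ × ℤ => (sA p.1 * sB p.2 - sB p.1 * sA p.2) * eC (((p.1 : ℂ) ^ 2 + (p.2 : ℂ) ^ 2) / 4 * τ)
        * eC (p.1 * ((z₁ + z₂) / 2) + p.2 * (I * (z₁ - z₂) / 2))) _ _ (hd τ hτ) h1
      have h3 := h2.mul_left (eC (-(τ / 4)))
      have e : eC (-(τ / 4)) * (H τ * eC (τ / 4) * Th τ z₁ z₂) = H τ * Th τ z₁ z₂ := by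
        have : eC (-(τ / 4)) * eC (τ / 4) = 1 := by rw [← eC_add, ← eC_zero]; congr 1; ring
        linear_combination H τ * Th τ z₁ z₂ * this
      rw [← e]
      refine h3.congr_fun ?_
      rintro ⟨n, a, b⟩
      simp only [Function.comp_apply, hι, le_add_iff_nonneg_left, zero_le, if_true, add_tsub_cancel_right]
      change _ = eC (-(τ / 4)) * (d n * eC (n * τ) * (cf a b * _ * _))
      rcases cf_or a b with h4 | h4
      · simp [h4]
      · have h5 : (a : ℂ) ^ 2 + (b : ℂ) ^ 2 = 4 * (eN a b : ℂ) + 1 := by exact_mod_cast h4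
        rw [h5]
        rw [show ((n + eN a b : ℕ) : ℂ) * τ + ((a : ℂ) + b * I) / 2 * z₁ + ((a : ℂ) - b * I) / 2 * z₂
          = -(τ / 4) + n * τ + (4 * (eN a b : ℂ) + 1) / 4 * τ + (a * ((z₁ + z₂) / 2) + b * (I * (z₁ - z₂) / 2)) by
            push_cast; ring]
        rw [eC_add, eC_add, eC_add]
        ring
    · rintro ⟨N, a, b⟩ h
      have : ¬ eN a b ≤ N := fun h' => h ⟨(N - eN a b, a, b), by simp [hι, h']⟩
      simp [this]

lemma part3 (k : ℕ) (hk : 0 < k) (hk4 : k % 4 = 2) (f : ℂ → ℂ) (hf : IsCF (k + 2) f) :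
    ∃ φ : ℂ → ℂ → ℂ → ℂ, IsHJF k 1 φ ∧ ∀ τ : ℂ, UHP τ → D2pi1 k φ τ = f τ := by
  set κ := ((k : ℂ) / (2 * (Real.pi : ℂ) * Complex.I)) with hκ
  have hκ0 : κ ≠ 0 := kap_ne k hk
  set H : ℂ → ℂ := fun τ => f τ / (κ * G τ) with hH
  have hHol : DifferentiableOn ℂ H {τ | UHP τ} :=
    hf.holo.div (G_holo.const_mul κ) fun τ hτ => mul_ne_zero hκ0 (G_ne hτ)
  have hT : ∀ τ, UHP τ → f (τ + 1) = f τ := fun τ hτ => by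
    have := hf.transf ModularGroup.T τ hτ
    simpa [Ma, Mb, Mc, Md, ModularGroup.coe_T] using this
  have e4 : ∀ τ, eC (-(τ / 4)) * eC (τ / 4) = 1 := fun τ => by
    rw [← eC_add, ← eC_zero]; congr 1; ring
  obtain ⟨d, d0, hd⟩ := qexp (fun τ => H τ * eC (τ / 4))
    (hHol.mul (diff_eC.comp (by fun_prop : Differentiable ℂ fun τ : ℂ => τ / 4)).differentiableOn)
    (fun τ hτ => by
      simp only [hH]
      rw [hT τ hτ, G_T hτ, show (τ + 1) / 4 = τ / 4 + 1 / 4 by ring, eC_add, eC_quarter]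
      have := G_ne hτ
      have := I_ne_zero
      field_simp)
    (by
      have h1 := (dec_im_tendsto f hf.decay).div (G_lim.const_mul κ)
        (by simp [hκ0])
      rw [zero_div] at h1
      refine h1.congr fun τ => ?_
      simp only [hH, Pi.div_apply]
      have h2 := eC_ne_zero (τ / 4)
      rw [eC_neg, ← div_eq_mul_inv]
      rw [← mul_div_assoc, div_div_eq_mul_div]
      ring)
  refine ⟨fun τ z₁ z₂ => H τ * Th τ z₁ z₂, ⟨?_, ?_, ?_, ?_⟩, fun τ hτ => ?_⟩
  · refine DifferentiableOn.mul ?_ Th_holo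
    exact hHol.comp (differentiable_fst.differentiableOn) fun p hp => hp
  · intro ε hε M τ z₁ z₂ hτ
    obtain ⟨χ, hχ, h1, h2⟩ := ThG_M M
    have hj := Mj_ne M τ hτ
    have hG := G_ne hτ
    have hχ0 : χ ≠ 0 := by rintro rfl; simp at hχ
    have h3 := h1 τ (ε * z₁) ((starRingEnd ℂ) ε * z₂) hτ
    rw [Th_eps k hk4 ε hε] at h3
    have hn : ε * (starRingEnd ℂ) ε = 1 := by
      rcases hε with rfl | rfl | rfl | rfl <;> simp
    have h4 : H (Mt M τ) * (χ * Mj M τ) = Mj M τ ^ k * H τ := by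
      simp only [hH]
      have := hf.transf M τ hτ
      change f (Mt M τ) = Mj M τ ^ (k + 2) * f τ at this
      rw [this, h2 τ hτ]
      field_simp
      ring
    change H (Mt M τ) * Th (Mt M τ) (ε * z₁ / Mj M τ) ((starRingEnd ℂ) ε * z₂ / Mj M τ) =
      ε ^ k * Mj M τ ^ k * eC (((1 : ℕ) : ℂ) * Mc M * z₁ * z₂ / Mj M τ) * (H τ * Th τ z₁ z₂)
    rw [h3, show ε * z₁ * ((starRingEnd ℂ) ε * z₂) * (Mc M / Mj M τ) =
      ((1 : ℕ) : ℂ) * Mc M * z₁ * z₂ / Mj M τ by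
        push_cast; linear_combination (z₁ * z₂ * (Mc M / Mj M τ)) * hn]
    linear_combination (eC (((1 : ℕ) : ℂ) * Mc M * z₁ * z₂ / Mj M τ) * ε ^ k * Th τ z₁ z₂) * h4
  · intro p q u v τ z₁ z₂ hτ
    beta_reduce
    rw [Th_ellip, Nat.cast_one, neg_one_mul]
    ring
  · obtain ⟨c, h1, h2⟩ := four_part H d d0 hd
    refine ⟨c, fun n a b h => h1 n a b (by simpa using h), h2⟩
  · rw [D2_formula k _ H (fun _ _ _ _ => rfl) hτ]
    have := G_ne hτ
    rw [← hκ]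
    simp only [hH]
    field_simp


/-- for `k ≡ 2 (mod 4)` the composite
`D₂ ∘ π₁ : J_{k,1}(O_K) → S_{k+2}` is an isomorphism. -/
theorem stmt3 (k : ℕ) (hk : 0 < k) (hk4 : k % 4 = 2) :
    (∀ φ : ℂ → ℂ → ℂ → ℂ, IsHJF k 1 φ → IsCF (k + 2) (D2pi1 k φ)) ∧
    (∀ φ φ' : ℂ → ℂ → ℂ → ℂ, IsHJF k 1 φ → IsHJF k 1 φ' →
      (∀ τ : ℂ, UHP τ → D2pi1 k φ τ = D2pi1 k φ' τ) →
      ∀ τ z₁ z₂ : ℂ, UHP τ → φ τ z₁ z₂ = φ' τ z₁ z₂) ∧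
    (∀ f : ℂ → ℂ, IsCF (k + 2) f →
      ∃ φ : ℂ → ℂ → ℂ → ℂ, IsHJF k 1 φ ∧ ∀ τ : ℂ, UHP τ → D2pi1 k φ τ = f τ) := by
  exact ⟨part1 k hk4, part2 k hk hk4, part3 k hk hk4⟩
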